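/- There exists an absolute constant c > 0 such that for every integer n ≥ 2 and every n-point metric space M = (M,d), c·log n is a distributional lower bound for metrical task systems on M (for a suitable initial state). Consequently, in every n-point metric space the randomized competitive ratio for MTS is Ω(log n); this universal lower bound is asymptotically tight. -/

import Mathlib

open scoped Classical ENNReal

/-- `d` is a metric on `M`. -/
def IsMetric {M : Type*} (d : M → M → ℝ) : Prop :=
  (∀ x y, d x y = 0 ↔ x = y) ∧ (∀ x y, d x y = d y x) ∧
    ∀ x y z, d x z ≤ d x y + d y z

/-- The state of the online MTS algorithm `A` (with initial state `x₀`) after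
serving the first `t` requests of `σ`. -/
def mtsState {M : Type*} (A : List (M → ℝ≥0∞) → M) (x₀ : M)
    (σ : List (M → ℝ≥0∞)) (t : ℕ) : M :=
  if t = 0 then x₀ else A (σ.take t)

/-- The cost of the deterministic online algorithm `A` on the MTS request
sequence `σ` (a list of cost vectors `M → [0,∞]`), with initial state `x₀`. -/
noncomputable def mtsCost {M : Type*} (d : M → M → ℝ) (A : List (M → ℝ≥0∞) → M) (x₀ : M)
    (σ : List (M → ℝ≥0∞)) : ℝ≥0∞ :=
  ∑ t ∈ Finset.range σ.length,
    (ENNReal.ofReal (d (mtsState A x₀ σ t) (mtsState A x₀ σ (t + 1))) +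
      σ.getD t (fun _ => 0) (mtsState A x₀ σ (t + 1)))

/-- Optimal (offline) cost of serving the MTS request sequence `σ` from `x₀`. -/
noncomputable def mtsOpt {M : Type*} (d : M → M → ℝ) (x₀ : M)
    (σ : List (M → ℝ≥0∞)) : ℝ≥0∞ :=
  ⨅ x : {x : ℕ → M // x 0 = x₀},
    ∑ t ∈ Finset.range σ.length,
      (ENNReal.ofReal (d (x.1 t) (x.1 (t + 1))) +
        σ.getD t (fun _ => 0) (x.1 (t + 1)))

/-- `C` is a distributional lower bound for metrical task systems on `(M,d)`
with initial state `x₀`. -/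
def MtsDLB {M : Type*} (d : M → M → ℝ) (x₀ : M) (C : ℝ) : Prop :=
  ∀ B : ℝ, 0 ≤ B → ∃ (N : ℕ) (P : Fin N → ℝ≥0∞) (ρ : Fin N → List (M → ℝ≥0∞)),
    (∑ ω, P ω) = 1 ∧
    ENNReal.ofReal B ≤ (∑ ω, P ω * mtsOpt d x₀ (ρ ω)) ∧
    ∀ A : List (M → ℝ≥0∞) → M,
      ENNReal.ofReal C * (∑ ω, P ω * mtsOpt d x₀ (ρ ω)) ≤
        ∑ ω, P ω * mtsCost d A x₀ (ρ ω)

open scoped NNReal BigOperators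

/-- A randomized experiment driven by independent fair coins: each node tosses `m` coins. -/
inductive CoinTree (α : Type*) : Type _
  | leaf : α → CoinTree α
  | node : (m : ℕ) → ((Fin m → Bool) → CoinTree α) → CoinTree α

namespace CoinTree

variable {α : Type*}

/-- The expectation of `f` over the outcome of a coin tree. -/
noncomputable def ev (f : α → ℝ) : CoinTree α → ℝ
  | leaf a => f a
  | node _ t => Finset.expect Finset.univ fun b => ev f (t b)

/-- Every outcome of the coin tree satisfies `P`. -/
def All (P : α → Prop) : CoinTree α → Prop
  | leaf a => P a
  | node _ t => ∀ b, All P (t b)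

theorem All.imp {P Q : α → Prop} (h : ∀ a, P a → Q a) : ∀ {p : CoinTree α}, All P p → All Q p
  | leaf a, hp => h a hp
  | node _ _, hp => fun b => All.imp h (hp b)

theorem all_true {P : α → Prop} (h : ∀ a, P a) : ∀ p : CoinTree α, All P p
  | leaf a => h a
  | node _ t => fun b => all_true h (t b)

theorem ev_mono_of_all {P : α → Prop} {f g : α → ℝ} (h : ∀ a, P a → f a ≤ g a) :
    ∀ {p : CoinTree α}, All P p → ev f p ≤ ev g p
  | leaf a, hp => h a hp
  | node _ _, hp => Finset.expect_le_expect fun b _ => ev_mono_of_all h (hp b)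

theorem ev_mono {f g : α → ℝ} (h : ∀ a, f a ≤ g a) (p : CoinTree α) : ev f p ≤ ev g p :=
  ev_mono_of_all (P := fun _ => True) (fun a _ => h a) (all_true (fun _ => trivial) p)

theorem ev_const (c : ℝ) : ∀ p : CoinTree α, ev (fun _ => c) p = c
  | leaf _ => rfl
  | node _ t => by simp [ev, ev_const c]

theorem ev_add (f g : α → ℝ) : ∀ p : CoinTree α, ev (fun a => f a + g a) p = ev f p + ev g p
  | leaf _ => rfl
  | node _ t => by simp [ev, ev_add f g, Finset.expect_add_distrib]

theorem ev_const_add (c : ℝ) (f : α → ℝ) (p : CoinTree α) :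
    ev (fun a => c + f a) p = c + ev f p := by
  rw [ev_add, ev_const]

theorem ev_add_const (c : ℝ) (f : α → ℝ) (p : CoinTree α) :
    ev (fun a => f a + c) p = ev f p + c := by
  rw [ev_add, ev_const]

theorem ev_const_mul (c : ℝ) (f : α → ℝ) : ∀ p : CoinTree α, ev (fun a => c * f a) p = c * ev f p
  | leaf _ => rfl
  | node _ t => by simp [ev, ev_const_mul c f, Finset.mul_expect]

theorem ev_nonneg {f : α → ℝ} (h : ∀ a, 0 ≤ f a) (p : CoinTree α) : 0 ≤ ev f p := by
  have := ev_mono h p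
  rwa [ev_const] at this

/-- Apply a function to every outcome. -/
def map {β : Type*} (f : α → β) : CoinTree α → CoinTree β
  | leaf a => leaf (f a)
  | node m t => node m fun b => map f (t b)

/-- Run `p` and then an independent copy of `q`, concatenating the outputs. -/
def seq : CoinTree (List α) → CoinTree (List α) → CoinTree (List α)
  | leaf σ, q => map (fun τ => σ ++ τ) q
  | node m t, q => node m fun b => seq (t b) q

theorem ev_map {β γ : Type*} (f : β → γ) (F : γ → ℝ) :
    ∀ p : CoinTree β, ev F (map f p) = ev (fun a => F (f a)) p
  | leaf _ => rfl
  | node _ t => by simp [ev, map, ev_map f F]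

theorem ev_seq (F : List α → ℝ) (q : CoinTree (List α)) :
    ∀ p : CoinTree (List α), ev F (seq p q) = ev (fun σ => ev (fun τ => F (σ ++ τ)) q) p
  | leaf σ => by simp [seq, ev, ev_map]
  | node _ t => by simp [ev, seq, ev_seq F q]

theorem All.map {β γ : Type*} {P : γ → Prop} {f : β → γ} :
    ∀ {p : CoinTree β}, All (fun a => P (f a)) p → All P (map f p)
  | leaf _, h => h
  | node _ _, h => fun b => All.map (h b)

theorem All.seq {P Q R : List α → Prop} (h : ∀ σ τ, P σ → Q τ → R (σ ++ τ)) :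
    ∀ {p q : CoinTree (List α)}, All P p → All Q q → All R (seq p q)
  | leaf σ, _, hp, hq => All.map (hq.imp fun τ hτ => h σ τ hp hτ)
  | node _ _, _, hp, hq => fun b => All.seq h (hp b) hq

/-- `n` independent runs of `p`. -/
def pow (p : CoinTree (List α)) : ℕ → CoinTree (List α)
  | 0 => leaf []
  | n + 1 => seq p (pow p n)

/-- Independent runs of finitely many trees, one after the other. -/
def seqFin : {m : ℕ} → (Fin m → CoinTree (List α)) → CoinTree (List α)
  | 0, _ => leaf []
  | _ + 1, q => seq (q 0) (seqFin fun i => q i.succ)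

theorem ev_pow_add (F : List α → ℝ) (p : CoinTree (List α)) (a b : ℕ) :
    ev F (pow p (a + b)) = ev (fun σ => ev (fun τ => F (σ ++ τ)) (pow p b)) (pow p a) := by
  induction a generalizing F with
  | zero => simp [pow, ev]
  | succ a ih =>
    rw [Nat.add_right_comm, pow, pow, ev_seq, ev_seq]
    congr 1
    funext σ
    rw [ih]
    simp

theorem All.pow {P : List α → Prop} (h0 : P []) (h : ∀ σ τ, P σ → P τ → P (σ ++ τ))
    {p : CoinTree (List α)} (hp : All P p) : ∀ n, All P (pow p n)
  | 0 => h0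
  | n + 1 => All.seq h hp (All.pow h0 h hp n)

theorem All.seqFin {P : List α → Prop} (h0 : P []) (h : ∀ σ τ, P σ → P τ → P (σ ++ τ)) :
    ∀ {m : ℕ} {q : Fin m → CoinTree (List α)}, (∀ i, All P (q i)) → All P (seqFin q)
  | 0, _, _ => h0
  | _ + 1, _, hq => All.seq h (hq 0) (All.seqFin h0 h fun i => hq i.succ)

/-- A coin tree is a finitely supported probability distribution. -/
theorem exists_finite_distribution (p : CoinTree α) :
    ∃ (N : ℕ) (P : Fin N → ℝ) (ρ : Fin N → α), (∀ i, 0 ≤ P i) ∧ ∑ i, P i = 1 ∧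
      (∀ f : α → ℝ, ∑ i, P i * f (ρ i) = ev f p) ∧ ∀ Q : α → Prop, All Q p → ∀ i, Q (ρ i) := by
  suffices h : ∃ (ι : Type) (_ : Fintype ι) (P : ι → ℝ) (ρ : ι → α), (∀ i, 0 ≤ P i) ∧
      ∑ i, P i = 1 ∧ (∀ f : α → ℝ, ∑ i, P i * f (ρ i) = ev f p) ∧
      ∀ Q : α → Prop, All Q p → ∀ i, Q (ρ i) by
    obtain ⟨ι, _, P, ρ, h0, h1, h2, h3⟩ := h
    let e := (Fintype.equivFin ι).symm
    refine ⟨Fintype.card ι, P ∘ e, ρ ∘ e, fun i => h0 _, ?_, fun f => ?_, fun Q hQ i => h3 Q hQ _⟩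
    · rw [← h1]
      exact Equiv.sum_comp e P
    · rw [← h2]
      exact Equiv.sum_comp e fun i => P i * f (ρ i)
  induction p with
  | leaf a => exact ⟨Unit, inferInstance, fun _ => 1, fun _ => a, by simp, by simp, by simp [ev],
      fun Q hQ _ => hQ⟩
  | node m t ih =>
    choose ι hι P ρ h0 h1 h2 h3 using ih
    refine ⟨Σ b, ι b, inferInstance, fun x => ((2 : ℝ) ^ m)⁻¹ * P x.1 x.2, fun x => ρ x.1 x.2,
      fun x => mul_nonneg (by positivity) (h0 _ _), ?_, fun f => ?_, fun Q hQ x => h3 _ Q (hQ _) _⟩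
    · rw [Fintype.sum_sigma]
      simp [← Finset.mul_sum, h1]
    · rw [Fintype.sum_sigma]
      simp only [mul_assoc, ← Finset.mul_sum, h2, ev]
      rw [Fintype.expect_eq_sum_div_card]
      simp [div_eq_inv_mul]

/-- Averages of products of functions of independent coins factor. -/
theorem expect_prod_coins {m : ℕ} (g : Fin m → Bool → ℝ) :
    (Finset.expect Finset.univ fun b : Fin m → Bool => ∏ i, g i (b i)) =
      ∏ i, (g i true + g i false) / 2 := by
  rw [Fintype.expect_eq_sum_div_card, Finset.prod_div_distrib]
  have := (Finset.prod_univ_sum (fun _ : Fin m => (Finset.univ : Finset Bool)) g).symm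
  rw [Fintype.piFinset_univ] at this
  simp [this]

/-- One toss of `m` coins. -/
def flips (m : ℕ) : CoinTree (List (Fin m → Bool)) := node m fun b => leaf [b]

/-- One toss of a single coin. -/
def coin : CoinTree (List Bool) := node 1 fun b => leaf [b 0]

theorem ev_pow_flips_succ {m : ℕ} (N : ℕ) (F : List (Fin m → Bool) → ℝ) :
    ev F (pow (flips m) (N + 1)) =
      Finset.expect Finset.univ fun b => ev (fun l => F (b :: l)) (pow (flips m) N) := by
  simp [pow, ev_seq, flips, ev]

theorem ev_pow_coin_succ (N : ℕ) (F : List Bool → ℝ) :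
    ev F (pow coin (N + 1)) =
      (ev (fun l => F (true :: l)) (pow coin N) + ev (fun l => F (false :: l)) (pow coin N)) / 2 := by
  have := expect_prod_coins (m := 1) (fun _ b => ev (fun l => F (b :: l)) (pow coin N))
  simp only [Fin.prod_univ_one] at this
  rw [← this]
  simp [pow, ev_seq, coin, ev]

/-- The columns of a matrix of independent coins are independent. -/
theorem ev_prod_columns {m : ℕ} (N : ℕ) (f : Fin m → List Bool → ℝ) :
    ev (fun bs => ∏ i, f i (bs.map fun b => b i)) (pow (flips m) N) =
      ∏ i, ev (f i) (pow coin N) := by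
  induction N generalizing f with
  | zero => simp [pow, ev]
  | succ N ih =>
    rw [ev_pow_flips_succ]
    simp only [ev_pow_coin_succ, List.map_cons]
    rw [← expect_prod_coins fun i c => ev (fun l => f i (c :: l)) (pow coin N)]
    congr 1
    funext b
    exact ih fun i l => f i (b i :: l)

end CoinTree

namespace TaskSystem
open CoinTree

variable {X : Type*}

/-- The cost of the online algorithm `A` on a request sequence, started in the given state, plus
the value of the potential `g` in its final state. -/
noncomputable def run (d : X → X → ℝ) (g : X → ℝ) :
    (List (X → ℝ≥0) → X) → X → List (X → ℝ≥0) → ℝ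
  | _, x, [] => g x
  | A, x, r :: σ => d x (A [r]) + r (A [r]) + run d g (fun l => A (r :: l)) (A [r]) σ

theorem run_append (d : X → X → ℝ) (g : X → ℝ) (A : List (X → ℝ≥0) → X) (x : X)
    (σ τ : List (X → ℝ≥0)) :
    run d g A x (σ ++ τ) = run d (fun y => run d g (fun l => A (σ ++ l)) y τ) A x σ := by
  induction σ generalizing A x with
  | nil => simp [run]
  | cons r σ ih => simp [run, ih]

theorem run_mono {d : X → X → ℝ} {g g' : X → ℝ} (h : ∀ x, g x ≤ g' x)
    (A : List (X → ℝ≥0) → X) (x : X) (σ : List (X → ℝ≥0)) : run d g A x σ ≤ run d g' A x σ := by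
  induction σ generalizing A x with
  | nil => exact h x
  | cons r σ ih => simpa [run] using ih _ _

theorem run_nonneg {d : X → X → ℝ} (hd : ∀ x y, 0 ≤ d x y) {g : X → ℝ} (h : ∀ x, 0 ≤ g x)
    (A : List (X → ℝ≥0) → X) (x : X) (σ : List (X → ℝ≥0)) : 0 ≤ run d g A x σ := by
  induction σ generalizing A x with
  | nil => exact h x
  | cons r σ ih =>
    have := ih (fun l => A (r :: l)) (A [r])
    have := hd x (A [r])
    have := (r (A [r])).2
    simp only [run]
    positivity

theorem ev_run (d : X → X → ℝ) {α : Type*} (q : CoinTree α) (g : α → X → ℝ)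
    (A : List (X → ℝ≥0) → X) (x : X) (σ : List (X → ℝ≥0)) :
    ev (fun a => run d (g a) A x σ) q = run d (fun y => ev (fun a => g a y) q) A x σ := by
  induction σ generalizing A x with
  | nil => simp [run]
  | cons r σ ih => simp [run, ev_const_add, ih]

/-- Every online algorithm started in `x` pays, in expectation over the random request sequence
`p`, at least the drop from `g' x` to the value of `g` in its final state. -/
def Triple (d : X → X → ℝ) (g' : X → ℝ) (p : CoinTree (List (X → ℝ≥0))) (g : X → ℝ) : Prop :=
  ∀ A x, g' x ≤ ev (fun σ => run d g A x σ) p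

theorem Triple.nil (d : X → X → ℝ) (g : X → ℝ) : Triple d g (leaf []) g :=
  fun _ _ => le_rfl

theorem Triple.seq {d : X → X → ℝ} {g₁ g₂ g₃ : X → ℝ} {p q : CoinTree (List (X → ℝ≥0))}
    (h₁ : Triple d g₁ p g₂) (h₂ : Triple d g₂ q g₃) : Triple d g₁ (seq p q) g₃ := by
  intro A x
  rw [ev_seq]
  refine (h₁ A x).trans (ev_mono (fun σ => ?_) p)
  simp only [run_append]
  rw [ev_run]
  exact run_mono (fun y => h₂ _ y) _ _ _

theorem Triple.node {d : X → X → ℝ} {m : ℕ} {G : (Fin m → Bool) → X → ℝ} {g' g : X → ℝ}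
    {t : (Fin m → Bool) → CoinTree (List (X → ℝ≥0))} (h : ∀ b, Triple d (G b) (t b) g)
    (hg : ∀ x, g' x = Finset.expect Finset.univ fun b => G b x) : Triple d g' (node m t) g := by
  intro A x
  rw [hg, ev]
  exact Finset.expect_le_expect fun b _ => h b A x

/-- `f` does not increase faster than `d`. -/
def Lip (d : X → X → ℝ) (f : X → ℝ) : Prop := ∀ x y, f x ≤ f y + d x y

theorem Triple.single {d : X → X → ℝ} {g : X → ℝ} {r : X → ℝ≥0}
    (h : Lip d fun x => g x + r x) : Triple d (fun x => g x + r x) (leaf [r]) g := by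
  intro A x
  have := h x (A [r])
  simp only [ev, run]
  linarith

/-- The potential equal to `a` on `S` and to `0` elsewhere. -/
noncomputable def bump (S : Set X) (a : ℝ) (x : X) : ℝ := if x ∈ S then a else 0

theorem Lip.add_bump {d : X → X → ℝ} {g : X → ℝ} {S : Set X} {a b : ℝ} (hg : Lip d g)
    (hb : Lip d fun x => g x + bump S b x) (ha : 0 ≤ a) (hab : a ≤ b) :
    Lip d fun x => g x + bump S a x := by
  intro x y
  have h1 := hg x y
  have h2 := hb x y
  simp only [bump] at h2 ⊢
  split_ifs at h2 ⊢ <;> linarith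

/-- Every online algorithm pays at least `v` in expectation on the random request sequence `p` if
it starts in `S`, provided leaving `S` is expensive with respect to the future costs `g`. -/
def Online (d : X → X → ℝ) (S : Set X) (p : CoinTree (List (X → ℝ≥0))) (v : ℝ) : Prop :=
  ∀ g : X → ℝ, Lip d g → (∀ x ∈ S, ∀ y ∈ S, g x = g y) → (Lip d fun x => g x + bump S (3 * v) x) →
    Triple d (fun x => g x + bump S v x) p g

theorem Online.pow {d : X → X → ℝ} {S : Set X} {p : CoinTree (List (X → ℝ≥0))} {v : ℝ}
    (h : Online d S p v) (hv : 0 ≤ v) {g : X → ℝ} (hg : Lip d g)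
    (hS : ∀ x ∈ S, ∀ y ∈ S, g x = g y) (n : ℕ)
    (hn : Lip d fun x => g x + bump S ((n + 2) * v) x) :
    Triple d (fun x => g x + bump S (n * v) x) (pow p n) g := by
  induction n with
  | zero =>
    have : (fun x => g x + bump S ((0 : ℕ) * v) x) = g := by
      funext x
      simp [bump]
    rw [this]
    exact Triple.nil d g
  | succ n ih =>
    have hnv : 0 ≤ (n : ℝ) * v := by positivity
    have ih' := ih (hg.add_bump hn (by positivity) (by push_cast; nlinarith))
    have h1 := h (fun x => g x + bump S (n * v) x)
      (hg.add_bump hn hnv (by push_cast; nlinarith))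
      (fun x hx y hy => by simp [bump, hx, hy, hS x hx y hy])
      (by
        convert hn using 2 with x
        simp only [bump]
        split_ifs
        · push_cast
          ring
        · ring)
    have h2 : (fun x => g x + bump S ((n + 1 : ℕ) * v) x) =
        fun x => g x + bump S (n * v) x + bump S v x := by
      funext x
      simp only [bump]
      split_ifs
      · push_cast
        ring
      · ring
    rw [h2]
    exact h1.seq ih'

theorem online_singleton {d : X → X → ℝ} (x : X) (v : ℝ≥0) :
    Online d {x} (leaf [fun y => if y = x then v else 0]) v := by
  intro g hg _ hv
  have h : (fun y => g y + bump {x} (v : ℝ) y) =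
      fun y => g y + ((if y = x then v else 0 : ℝ≥0) : ℝ) := by
    funext y
    by_cases hy : y = x <;> simp [bump, hy]
  have h' := hg.add_bump hv v.coe_nonneg (by linarith [v.coe_nonneg])
  rw [h] at h' ⊢
  exact Triple.single h'

/-- Pairwise separation of a family of sets. -/
def Separated (d : X → X → ℝ) {ι : Type*} (S : ι → Set X) (δ : ℝ) : Prop :=
  ∀ i j, i ≠ j → ∀ x ∈ S i, ∀ y ∈ S j, δ ≤ d x y

/-- The part of a random step in which the coins show `b`. -/
def stepWith {α : Type*} {m : ℕ} (q : Fin m → CoinTree (List α)) (b : Fin m → Bool) :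
    CoinTree (List α) :=
  seqFin fun i => if b i then q i else leaf []

theorem triple_seqFin {d : X → X → ℝ} {m : ℕ} (G : ℕ → X → ℝ)
    (q : Fin m → CoinTree (List (X → ℝ≥0)))
    (h : ∀ i : Fin m, Triple d (G i) (q i) (G (i + 1))) : Triple d (G 0) (seqFin q) (G m) := by
  induction m generalizing G with
  | zero => exact Triple.nil d _
  | succ m ih =>
    exact (h 0).seq (ih (fun k => G (k + 1)) (fun i => q i.succ) fun i => by
      simpa using h i.succ)

theorem bump_sum_apply {m : ℕ} {d : X → X → ℝ} (hd : ∀ x, d x x = 0) {S : Fin m → Set X} {δ : ℝ}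
    (hδ : 0 < δ) (hS : Separated d S δ) (a : Fin m → ℝ) {i : Fin m} {x : X} (hx : x ∈ S i) :
    ∑ j, bump (S j) (a j) x = a i := by
  rw [Finset.sum_eq_single i]
  · simp [bump, hx]
  · intro j _ hj
    have : x ∉ S j := fun h => by
      have := hS j i hj x h x hx
      rw [hd] at this
      linarith
    simp [bump, this]
  · simp

theorem bump_sum_apply_of_notMem {m : ℕ} {S : Fin m → Set X} (a : Fin m → ℝ) {x : X}
    (hx : x ∉ ⋃ i, S i) : ∑ j, bump (S j) (a j) x = 0 := by
  refine Finset.sum_eq_zero fun j _ => ?_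
  have : x ∉ S j := fun h => hx (Set.mem_iUnion.2 ⟨j, h⟩)
  simp [bump, this]

theorem lip_add_bumps {m : ℕ} {d : X → X → ℝ} (hd : ∀ x, d x x = 0) (hd0 : ∀ x y, 0 ≤ d x y)
    {S : Fin m → Set X} {δ : ℝ} (hδ : 0 < δ) (hS : Separated d S δ) {g : X → ℝ} (hg : Lip d g)
    (hgS : ∀ x ∈ ⋃ i, S i, ∀ y ∈ ⋃ i, S i, g x = g y)
    (hb : Lip d fun x => g x + bump (⋃ i, S i) δ x) (a : Fin m → ℝ) (ha : ∀ i, 0 ≤ a i)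
    (ha' : ∀ i, a i ≤ δ) : Lip d fun x => g x + ∑ i, bump (S i) (a i) x := by
  intro x y
  beta_reduce
  by_cases hx : x ∈ ⋃ i, S i
  · obtain ⟨i, hi⟩ := Set.mem_iUnion.1 hx
    simp only [bump_sum_apply hd hδ hS a hi]
    by_cases hy : y ∈ ⋃ i, S i
    · obtain ⟨j, hj⟩ := Set.mem_iUnion.1 hy
      rw [bump_sum_apply hd hδ hS a hj, hgS x hx y hy]
      by_cases hij : i = j
      · subst hij
        linarith [hd0 x y]
      · linarith [hS i j hij x hi y hj, ha' i, ha j]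
    · rw [bump_sum_apply_of_notMem a hy]
      have := hb x y
      simp only [bump, hx, hy, if_true, if_false] at this
      linarith [ha' i]
  · rw [bump_sum_apply_of_notMem a hx]
    by_cases hy : y ∈ ⋃ i, S i
    · obtain ⟨j, hj⟩ := Set.mem_iUnion.1 hy
      rw [bump_sum_apply hd hδ hS a hj]
      linarith [hg x y, ha j]
    · rw [bump_sum_apply_of_notMem a hy]
      linarith [hg x y]

theorem online_merge {m : ℕ} {d : X → X → ℝ} (hd : ∀ x, d x x = 0) (hd0 : ∀ x y, 0 ≤ d x y)
    {S : Fin m → Set X} {v : ℝ} (hv : 0 < v) (hS : Separated d S (4 * v))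
    (p : Fin m → CoinTree (List (X → ℝ≥0))) (hp : ∀ i, Online d (S i) (p i) (v / 16)) :
    Online d (⋃ i, S i) (node m (stepWith fun i => pow (p i) 32)) v := by
  intro g hg hgS hb
  have hS3 : Separated d S (3 * v) := fun i j hij x hx y hy => by
    linarith [hS i j hij x hx y hy]
  have h3v : 0 < 3 * v := by linarith
  have key : ∀ a : Fin m → ℝ, (∀ i, 0 ≤ a i) → (∀ i, a i ≤ 3 * v) →
      Lip d fun x => g x + ∑ i, bump (S i) (a i) x :=
    fun a => lip_add_bumps hd hd0 h3v hS3 hg hgS hb a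
  refine Triple.node (G := fun b x => g x + ∑ i, bump (S i) (if b i then 2 * v else 0) x)
    (fun b => ?_) fun x => ?_
  · let a : ℕ → Fin m → ℝ := fun k i => if k ≤ (i : ℕ) then if b i then 2 * v else 0 else 0
    have ha : ∀ k i, 0 ≤ a k i := fun k i => by
      simp only [a]
      split_ifs <;> linarith
    have ha' : ∀ k i, a k i ≤ 2 * v := fun k i => by
      simp only [a]
      split_ifs <;> linarith
    have := triple_seqFin (d := d) (fun k x => g x + ∑ i, bump (S i) (a k i) x)
      (fun i => if b i then pow (p i) 32 else leaf []) ?_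
    · have e0 : (fun x => g x + ∑ i, bump (S i) (a 0 i) x) =
          fun x => g x + ∑ i, bump (S i) (if b i then 2 * v else 0) x := by simp [a]
      have e1 : (fun x => g x + ∑ i, bump (S i) (a m i) x) = g := by
        funext x
        have : ∀ i : Fin m, a m i = 0 := fun i => by simp [a]
        simp [this, bump]
      rw [e0, e1] at this
      exact this
    · intro i
      by_cases hbi : b i
      · have hupd : ∀ c : ℝ, (fun x => g x + ∑ j, bump (S j) (a (i + 1) j) x + bump (S i) c x) =
            fun x => g x + ∑ j, bump (S j) (Function.update (a (i + 1)) i c j) x := by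
          intro c
          funext x
          rw [add_assoc]
          congr 1
          rw [← Finset.add_sum_erase _ _ (Finset.mem_univ i),
            ← Finset.add_sum_erase (a := i) _ (fun j => bump (S j) _ x) (Finset.mem_univ i)]
          have h1 : bump (S i) (a (i + 1) i) x = 0 := by simp [a, bump]
          rw [h1, Function.update_self, zero_add, add_comm]
          congr 1
          refine Finset.sum_congr rfl fun j hj => ?_
          rw [Function.update_of_ne (Finset.ne_of_mem_erase hj)]
        have hlip : ∀ c : ℝ, 0 ≤ c → c ≤ 3 * v →
            Lip d fun x => g x + ∑ j, bump (S j) (a (i + 1) j) x + bump (S i) c x := by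
          intro c hc hc'
          rw [hupd]
          refine key _ (fun j => ?_) fun j => ?_
          · by_cases hj : j = i
            · subst hj
              simpa using hc
            · simpa [Function.update_of_ne hj] using ha _ j
          · by_cases hj : j = i
            · subst hj
              simpa using hc'
            · rw [Function.update_of_ne hj]
              linarith [ha' (i + 1) j]
        have hpow := (hp i).pow (by linarith) (g := fun x => g x + ∑ j, bump (S j) (a (i + 1) j) x)
          (key _ (ha _) fun j => by linarith [ha' (i + 1) j])
          (fun x hx y hy => by
            rw [bump_sum_apply hd h3v hS3 _ hx, bump_sum_apply hd h3v hS3 _ hy,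
              hgS x (Set.mem_iUnion.2 ⟨i, hx⟩) y (Set.mem_iUnion.2 ⟨i, hy⟩)]) 32
          (hlip _ (by push_cast; linarith) (by push_cast; linarith))
        have e : (fun x => g x + ∑ j, bump (S j) (a i j) x) =
            fun x => g x + ∑ j, bump (S j) (a (i + 1) j) x +
              bump (S i) ((32 : ℕ) * (v / 16)) x := by
          rw [hupd]
          have : a i = Function.update (a (i + 1)) i ((32 : ℕ) * (v / 16)) := by
            funext j
            by_cases hj : j = i
            · subst hj
              simp only [a, le_refl, if_true, hbi, Function.update_self]
              push_cast
              ring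
            · have hj' : (j : ℕ) ≠ i := fun h => hj (Fin.ext h)
              have : ((i : ℕ) ≤ j) ↔ ((i : ℕ) + 1 ≤ j) := by omega
              simp only [a, Function.update_of_ne hj, this]
          rw [← this]
        simp only [hbi, if_true]
        rw [e]
        exact hpow
      · have : a i = a (i + 1) := by
          funext j
          by_cases hj : j = i
          · subst hj
            simp [a, hbi]
          · have hj' : (j : ℕ) ≠ i := fun h => hj (Fin.ext h)
            have : ((i : ℕ) ≤ j) ↔ ((i : ℕ) + 1 ≤ j) := by omega
            simp only [a, this]
        simp only [hbi]
        rw [this]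
        exact Triple.nil d _
  · rw [Finset.expect_add_distrib, Finset.expect_const Finset.univ_nonempty]
    congr 1
    by_cases hx : x ∈ ⋃ i, S i
    · obtain ⟨i, hi⟩ := Set.mem_iUnion.1 hx
      have h1 : ∀ b : Fin m → Bool, ∑ j, bump (S j) (if b j then 2 * v else 0) x =
          ∏ j, if j = i then (if b j then 2 * v else 0) else 1 := fun b => by
        rw [bump_sum_apply hd h3v hS3 _ hi]
        simp
      simp only [h1]
      rw [expect_prod_coins fun j c => if j = i then (if c then 2 * v else 0) else 1]
      simp only [bump, hx, if_true]
      rw [Finset.prod_eq_single i]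
      · simp
      · intro j _ hj
        simp [hj]
      · simp
    · simp only [bump_sum_apply_of_notMem _ hx]
      simp [bump, hx]

end TaskSystem

namespace CoinTree

variable {α : Type*}

theorem ev_expect {ι : Type*} [Fintype ι] (f : ι → α → ℝ) :
    ∀ p : CoinTree α, ev (fun a => Finset.expect Finset.univ fun i => f i a) p =
      Finset.expect Finset.univ fun i => ev (f i) p
  | leaf _ => rfl
  | node m t => by
    simp only [ev, ev_expect f]
    exact Finset.expect_comm _ _ _

theorem ev_comm {β : Type*} (F : α → β → ℝ) (q : CoinTree β) :
    ∀ p : CoinTree α, ev (fun a => ev (F a) q) p = ev (fun b => ev (fun a => F a b) p) q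
  | leaf _ => rfl
  | node m t => by
    simp only [ev, ev_comm F q]
    rw [← ev_expect]

end CoinTree

namespace TaskSystem
open CoinTree

variable {X : Type*}

/-- `Serve d S x σ w z`: starting in `x`, the request sequence `σ` can be served at cost `z` by
moving within `S` and ending in `w`. -/
inductive Serve (d : X → X → ℝ) (S : Set X) : X → List (X → ℝ≥0) → X → ℝ → Prop
  | nil (x : X) : Serve d S x [] x 0
  | cons {x y w : X} {r : X → ℝ≥0} {σ : List (X → ℝ≥0)} {z : ℝ} :
      y ∈ S → Serve d S y σ w z → Serve d S x (r :: σ) w (d x y + r y + z)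

variable {d : X → X → ℝ} {S : Set X}

theorem Serve.mem {x w : X} {σ : List (X → ℝ≥0)} {z : ℝ} (h : Serve d S x σ w z) (hx : x ∈ S) :
    w ∈ S := by
  induction h with
  | nil => exact hx
  | cons hy _ ih => exact ih hy

theorem Serve.nonneg (hd : ∀ x y, 0 ≤ d x y) {x w : X} {σ : List (X → ℝ≥0)} {z : ℝ}
    (h : Serve d S x σ w z) : 0 ≤ z := by
  induction h with
  | nil => exact le_rfl
  | @cons x y w r σ z hy _ ih => linarith [hd x y, (r y).coe_nonneg]

theorem Serve.append {x y w : X} {σ τ : List (X → ℝ≥0)} {a b : ℝ} (h : Serve d S x σ y a)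
    (h' : Serve d S y τ w b) : Serve d S x (σ ++ τ) w (a + b) := by
  induction h with
  | nil => simpa using h'
  | cons hy _ ih =>
    rw [add_assoc]
    exact Serve.cons hy (ih h')

theorem Serve.split {x w : X} {σ τ : List (X → ℝ≥0)} {c : ℝ} (h : Serve d S x (σ ++ τ) w c) :
    ∃ y a b, Serve d S x σ y a ∧ Serve d S y τ w b ∧ c = a + b := by
  induction σ generalizing x c with
  | nil => exact ⟨x, 0, c, Serve.nil x, h, by simp⟩
  | cons r σ ih =>
    cases h with
    | cons hy h =>
      obtain ⟨y', a, b, ha, hb, rfl⟩ := ih h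
      exact ⟨y', _, b, Serve.cons hy ha, hb, by ring⟩

theorem Serve.mono {S' : Set X} (hS : S' ⊆ S) {x w : X} {σ : List (X → ℝ≥0)} {z : ℝ}
    (h : Serve d S' x σ w z) : Serve d S x σ w z := by
  induction h with
  | nil => exact Serve.nil _
  | cons hy _ ih => exact Serve.cons (hS hy) ih

theorem Serve.stay (hd : ∀ x, d x x = 0) {x : X} (hx : x ∈ S) (σ : List (X → ℝ≥0)) :
    Serve d S x σ x (σ.map fun r => (r x : ℝ)).sum := by
  induction σ with
  | nil => exact Serve.nil x
  | cons r σ ih =>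
    have := Serve.cons (d := d) (x := x) (r := r) hx ih
    rw [hd, zero_add] at this
    simpa using this

theorem Serve.stay_of_eq_zero (hd : ∀ x, d x x = 0) {x : X} (hx : x ∈ S) {σ : List (X → ℝ≥0)}
    (hσ : ∀ r ∈ σ, r x = 0) : Serve d S x σ x 0 := by
  convert Serve.stay hd hx σ
  symm
  refine List.sum_eq_zero fun a ha => ?_
  obtain ⟨r, hr, rfl⟩ := List.mem_map.1 ha
  simp [hσ r hr]

/-- From every state of `S`, the request sequence `σ` can be served within `S` at cost at
most `z`. -/
def Can (d : X → X → ℝ) (S : Set X) (σ : List (X → ℝ≥0)) (z : ℝ) : Prop :=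
  ∀ x ∈ S, ∃ w, ∃ z' ≤ z, Serve d S x σ w z'

/-- The optimal cost of serving `σ` within `S` from the worst initial state. -/
noncomputable def om (d : X → X → ℝ) (S : Set X) (σ : List (X → ℝ≥0)) : ℝ :=
  sInf {z | Can d S σ z}

theorem Can.nonneg (hd : ∀ x y, 0 ≤ d x y) (hS : S.Nonempty) {σ : List (X → ℝ≥0)} {z : ℝ}
    (h : Can d S σ z) : 0 ≤ z := by
  obtain ⟨x, hx⟩ := hS
  obtain ⟨w, z', hz, h'⟩ := h x hx
  exact (h'.nonneg hd).trans hz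

theorem om_le (hd : ∀ x y, 0 ≤ d x y) (hS : S.Nonempty) {σ : List (X → ℝ≥0)} {z : ℝ}
    (h : Can d S σ z) : om d S σ ≤ z :=
  csInf_le ⟨0, fun _ h => Can.nonneg hd hS h⟩ h

theorem om_nonneg (hd : ∀ x y, 0 ≤ d x y) (hS : S.Nonempty) (σ : List (X → ℝ≥0)) :
    0 ≤ om d S σ :=
  Real.sInf_nonneg fun _ h => Can.nonneg hd hS h

theorem exists_can [Finite X] (hd : ∀ x, d x x = 0) (σ : List (X → ℝ≥0)) :
    {z | Can d S σ z}.Nonempty := by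
  obtain ⟨z, hz⟩ := (Set.finite_range fun x : X => (σ.map fun r => (r x : ℝ)).sum).bddAbove
  exact ⟨z, fun x hx => ⟨x, _, hz ⟨x, rfl⟩, Serve.stay hd hx σ⟩⟩

theorem le_om [Finite X] (hd : ∀ x, d x x = 0) {σ : List (X → ℝ≥0)} {c : ℝ}
    (h : ∀ z, Can d S σ z → c ≤ z) : c ≤ om d S σ :=
  le_csInf (exists_can hd σ) h

theorem om_const_le (hd : ∀ x, d x x = 0) (hd0 : ∀ x y, 0 ≤ d x y) (hS : S.Nonempty) (a : ℝ≥0) :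
    om d S [fun _ => a] ≤ a :=
  om_le hd0 hS fun x hx => ⟨x, a, le_rfl, by simpa using Serve.stay hd hx [fun _ => a]⟩

/-- There is a random request sequence supported in `S` that costs `v` online, and long
repetitions of which cost `C` times less per round offline. -/
def Val (d : X → X → ℝ) (S : Set X) (v C : ℝ) : Prop :=
  ∃ p : CoinTree (List (X → ℝ≥0)), All (fun σ => ∀ r ∈ σ, ∀ x ∉ S, r x = 0) p ∧
    Online d S p v ∧ ∀ N : ℕ, ev (om d S) (pow p N) ≤ v / C * N + 512 * v

theorem Val.mono {v C C' : ℝ} (h : Val d S v C) (hC' : 0 < C') (hC : C' ≤ C) (hv : 0 ≤ v) :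
    Val d S v C' := by
  obtain ⟨p, h1, h2, h3⟩ := h
  refine ⟨p, h1, h2, fun N => (h3 N).trans ?_⟩
  gcongr

theorem val_singleton (hd : ∀ x, d x x = 0) (hd0 : ∀ x y, 0 ≤ d x y) (x : X) {v : ℝ}
    (hv : 0 ≤ v) : Val d {x} v 1 := by
  lift v to ℝ≥0 using hv
  refine ⟨leaf [fun y => if y = x then v else 0], ?_, online_singleton x v, fun N => ?_⟩
  · intro r hr y hy
    simp only [List.mem_singleton] at hr
    subst hr
    have : y ≠ x := hy
    simp [this]
  · have h : ∀ N : ℕ, ev (om d {x}) (pow (leaf [fun y => if y = x then v else 0]) N) ≤ v * N := by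
      intro N
      have key : ∀ N : ℕ, All (fun σ : List (X → ℝ≥0) => (σ.map fun r => (r x : ℝ)).sum ≤ v * N)
          (pow (leaf [fun y => if y = x then v else 0]) N) := by
        intro N
        induction N with
        | zero => simp [pow, All]
        | succ N ih =>
          refine All.map (ih.imp fun σ hσ => ?_)
          push_cast
          simp only [List.singleton_append, List.map_cons, if_true, List.sum_cons]
          linarith
      have := ev_mono_of_all (f := om d {x}) (g := fun _ => (v : ℝ) * N) (fun σ hσ => ?_) (key N)
      · rwa [ev_const] at this
      · refine om_le hd0 (Set.singleton_nonempty x) fun y hy => ?_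
        rw [Set.mem_singleton_iff] at hy
        subst hy
        exact ⟨y, _, hσ, Serve.stay hd (Set.mem_singleton y) σ⟩
    have := v.coe_nonneg
    linarith [h N]

variable [Finite X]

theorem om_append_le (hd : ∀ x, d x x = 0) (hd0 : ∀ x y, 0 ≤ d x y) (hS : S.Nonempty)
    (σ τ : List (X → ℝ≥0)) : om d S (σ ++ τ) ≤ om d S σ + om d S τ := by
  rw [← sub_le_iff_le_add]
  refine le_om hd fun a ha => ?_
  rw [sub_le_comm]
  refine le_om hd fun b hb => ?_
  rw [sub_le_iff_le_add']
  refine om_le hd0 hS fun x hx => ?_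
  obtain ⟨y, a', ha', h1⟩ := ha x hx
  obtain ⟨w, b', hb', h2⟩ := hb y (h1.mem hx)
  exact ⟨w, _, add_le_add ha' hb', h1.append h2⟩

theorem om_le_om_append (hd : ∀ x, d x x = 0) (hd0 : ∀ x y, 0 ≤ d x y) (hS : S.Nonempty)
    (σ τ : List (X → ℝ≥0)) : om d S σ ≤ om d S (σ ++ τ) := by
  refine le_om hd fun z hz => om_le hd0 hS fun x hx => ?_
  obtain ⟨w, z', hz', h⟩ := hz x hx
  obtain ⟨y, a, b, ha, hb, rfl⟩ := h.split
  exact ⟨y, a, by linarith [hb.nonneg hd0], ha⟩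

theorem om_insert_le (hd : ∀ x, d x x = 0) (hd0 : ∀ x y, 0 ≤ d x y) (hS : S.Nonempty)
    (σ τ υ : List (X → ℝ≥0)) (hτ : ∀ r ∈ τ, ∀ x ∈ S, r x = 0) :
    om d S (σ ++ (τ ++ υ)) ≤ om d S (σ ++ υ) := by
  refine le_om hd fun z hz => om_le hd0 hS fun x hx => ?_
  obtain ⟨w, z', hz', h⟩ := hz x hx
  obtain ⟨y, a, b, ha, hb, rfl⟩ := h.split
  have hy := ha.mem hx
  refine ⟨w, a + (0 + b), by simpa using hz', ha.append (Serve.append ?_ hb)⟩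
  exact Serve.stay_of_eq_zero hd hy fun r hr => hτ r hr y hy

theorem om_le_diam_add_om (hd : ∀ x, d x x = 0) (hd0 : ∀ x y, 0 ≤ d x y)
    (htri : ∀ x y z, d x z ≤ d x y + d y z) {S' : Set X} (hS' : S'.Nonempty) (hSS : S' ⊆ S) {D : ℝ}
    (hD : ∀ x ∈ S, ∀ y ∈ S, d x y ≤ D) (σ : List (X → ℝ≥0)) :
    om d S σ ≤ D + om d S' σ := by
  rw [← sub_le_iff_le_add']
  refine le_om hd fun z hz => ?_
  rw [sub_le_iff_le_add']
  obtain ⟨y, hy⟩ := hS'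
  refine om_le hd0 ⟨y, hSS hy⟩ fun x hx => ?_
  obtain ⟨w, z', hz', h⟩ := hz y hy
  have hxy := hD x hx y (hSS hy)
  cases h with
  | nil => exact ⟨x, 0, by linarith [hd0 x y], Serve.nil x⟩
  | @cons _ y' w r σ z'' hy' h =>
    refine ⟨w, _, ?_, Serve.cons (hSS hy') (h.mono hSS)⟩
    linarith [htri x y y']

/-- Inserting requests that satisfy `P` does not increase `F`. -/
def NullIns {α : Type*} (P : α → Prop) (F : List α → ℝ) : Prop :=
  ∀ σ τ υ, (∀ r ∈ τ, P r) → F (σ ++ (τ ++ υ)) ≤ F (σ ++ υ)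

theorem NullIns.append_left {α : Type*} {P : α → Prop} {F : List α → ℝ} (h : NullIns P F)
    (σ : List α) : NullIns P fun τ => F (σ ++ τ) := fun σ' τ υ hτ => by
  simpa using h (σ ++ σ') τ υ hτ

theorem NullIns.ev_right {α : Type*} {P : α → Prop} {F : List α → ℝ} (h : NullIns P F)
    (p : CoinTree (List α)) : NullIns P fun σ => ev (fun τ => F (σ ++ τ)) p :=
  fun σ τ υ hτ => ev_mono (fun β => by simpa using h σ τ (υ ++ β) hτ) p

theorem ev_seqFin_le_of_all {α : Type*} {P : α → Prop} {m : ℕ} {q : Fin m → CoinTree (List α)}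
    (hq : ∀ i, All (fun τ => ∀ r ∈ τ, P r) (q i)) {F : List α → ℝ} (hF : NullIns P F) :
    ev F (seqFin q) ≤ F [] := by
  have : All (fun τ => ∀ r ∈ τ, P r) (seqFin q) := All.seqFin (by simp)
    (fun σ τ hσ hτ r hr => (List.mem_append.1 hr).elim (hσ r) (hτ r)) hq
  have h := ev_mono_of_all (f := F) (g := fun _ => F [])
    (fun τ hτ => by simpa using hF [] τ [] hτ) this
  rwa [ev_const] at h

theorem ev_seqFin_le {α : Type*} {P : α → Prop} {m : ℕ} {q : Fin m → CoinTree (List α)}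
    (i : Fin m) (hq : ∀ j, j ≠ i → All (fun τ => ∀ r ∈ τ, P r) (q j)) {F : List α → ℝ}
    (hF : NullIns P F) : ev F (seqFin q) ≤ ev F (q i) := by
  induction m with
  | zero => exact i.elim0
  | succ m ih =>
    rw [seqFin, ev_seq]
    refine Fin.cases (fun hq => ?_) (fun i hq => ?_) i hq
    · refine ev_mono (fun σ => ?_) _
      simpa using ev_seqFin_le_of_all (fun j => hq j.succ (Fin.succ_ne_zero j)) (hF.append_left σ)
    · refine le_trans ?_ (ih (q := fun i => q i.succ) i fun j hj =>
        hq j.succ fun h => hj (Fin.succ_injective _ h))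
      have h := ev_mono_of_all (f := fun σ => ev (fun τ => F (σ ++ τ)) (seqFin fun i => q i.succ))
        (g := fun _ => ev F (seqFin fun i => q i.succ))
        (fun σ hσ => ev_mono (fun τ => by simpa using hF [] σ τ hσ) _)
        (hq 0 (Fin.succ_ne_zero i).symm)
      rwa [ev_const] at h

/-- The part of a random process in which the coins show `bs`. -/
def stepsWith {α : Type*} {m : ℕ} (q : Fin m → CoinTree (List α)) :
    List (Fin m → Bool) → CoinTree (List α)
  | [] => leaf []
  | b :: bs => seq (stepWith q b) (stepsWith q bs)

theorem ev_stepsWith_append {α : Type*} {m : ℕ} (q : Fin m → CoinTree (List α)) (F : List α → ℝ)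
    (bs bs' : List (Fin m → Bool)) : ev F (stepsWith q (bs ++ bs')) =
      ev (fun σ => ev (fun τ => F (σ ++ τ)) (stepsWith q bs')) (stepsWith q bs) := by
  induction bs generalizing F with
  | nil => simp [stepsWith, ev]
  | cons b bs ih => simp [stepsWith, ev_seq, ih]

theorem ev_pow_node_stepWith {α : Type*} {m : ℕ} (q : Fin m → CoinTree (List α))
    (F : List α → ℝ) (N : ℕ) : ev F (pow (node m (stepWith q)) N) =
      ev (fun bs => ev F (stepsWith q bs)) (pow (flips m) N) := by
  induction N generalizing F with
  | zero => simp [pow, stepsWith, ev]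
  | succ N ih =>
    rw [ev_pow_flips_succ, pow, ev_seq, ev]
    congr 1
    funext b
    simp only [ih, stepsWith, ev_seq]
    exact ev_comm _ _ _

/-- The number of times the `i`-th coin shows heads. -/
def heads {m : ℕ} (i : Fin m) (bs : List (Fin m → Bool)) : ℕ := (bs.map fun b => b i).count true

theorem heads_append {m : ℕ} (i : Fin m) (bs bs' : List (Fin m → Bool)) :
    heads i (bs ++ bs') = heads i bs + heads i bs' := by
  simp [heads]

theorem ev_stepsWith_le {α : Type*} {P : α → Prop} {m : ℕ} {p : Fin m → CoinTree (List α)}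
    (i : Fin m) (k : ℕ) (hp : ∀ j, j ≠ i → All (fun τ => ∀ r ∈ τ, P r) (p j)) {F : List α → ℝ}
    (hF : NullIns P F) (bs : List (Fin m → Bool)) :
    ev F (stepsWith (fun j => pow (p j) k) bs) ≤ ev F (pow (p i) (k * heads i bs)) := by
  induction bs generalizing F with
  | nil => simp [stepsWith, heads, pow]
  | cons b bs ih =>
    rw [stepsWith, ev_seq]
    refine (ev_mono (fun σ => ih (hF.append_left σ)) _).trans ?_
    refine (ev_seqFin_le i (fun j hj => ?_) (hF.ev_right _)).trans ?_
    · split_ifs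
      · exact All.pow (by simp)
          (fun σ τ hσ hτ r hr => (List.mem_append.1 hr).elim (hσ r) (hτ r)) (hp j hj) k
      · simp [All]
    · cases hb : b i with
      | true =>
        simp only [if_true]
        rw [← ev_pow_add]
        simp [heads, hb, mul_add, add_comm]
      | false => simp [heads, hb, ev]

/-- The offline cost of a process composed of processes on well separated clusters is governed by
a function of the coins that select the active clusters. -/
theorem val_iUnion {m : ℕ} (hd : ∀ x, d x x = 0) (hd0 : ∀ x y, 0 ≤ d x y)
    (htri : ∀ x y z, d x z ≤ d x y + d y z) {S : Fin (m + 1) → Set X} {v : ℝ} (hv : 0 < v)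
    (hne : ∀ i, (S i).Nonempty) (hsep : Separated d S (4 * v))
    (hdiam : ∀ x ∈ ⋃ i, S i, ∀ y ∈ ⋃ i, S i, d x y ≤ 64 * v) {C : Fin (m + 1) → ℝ}
    (hC : ∀ i, Val d (S i) (v / 16) (C i)) :
    ∃ V : List (Fin (m + 1) → Bool) → ℝ,
      (∀ l l', V (l ++ l') ≤ V l + V l') ∧ (∀ l l', V l ≤ V (l ++ l')) ∧
      (∀ i l, V l ≤ 128 * v + 2 * v / C i * heads i l) ∧
      ∀ C', (∀ N : ℕ, ev V (pow (flips (m + 1)) N) ≤ v / C' * N + 512 * v) →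
        Val d (⋃ i, S i) v C' := by
  choose p hsupp honl hoff using hC
  have hne' : (⋃ i, S i).Nonempty := (hne 0).mono (Set.subset_iUnion S 0)
  refine ⟨fun l => ev (om d (⋃ i, S i)) (stepsWith (fun i => pow (p i) 32) l), fun l l' => ?_,
    fun l l' => ?_, fun i l => ?_, fun C' hC' => ⟨node _ (stepWith fun i => pow (p i) 32), ?_,
      online_merge hd hd0 hv hsep p honl, fun N => ?_⟩⟩
  · beta_reduce
    rw [ev_stepsWith_append]
    have := ev_mono (fun σ => (ev_mono (fun τ => om_append_le hd hd0 hne' σ τ)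
      (stepsWith (fun i => pow (p i) 32) l')).trans (ev_const_add _ _ _).le)
      (stepsWith (fun i => pow (p i) 32) l)
    rwa [ev_add_const] at this
  · beta_reduce
    rw [ev_stepsWith_append]
    refine ev_mono (fun σ => ?_) _
    have := ev_mono (fun τ => om_le_om_append hd hd0 hne' σ τ)
      (stepsWith (fun i => pow (p i) 32) l')
    rwa [ev_const] at this
  · have h1 := ev_mono (fun σ => om_le_diam_add_om hd hd0 htri (hne i) (Set.subset_iUnion S i)
      hdiam σ) (stepsWith (fun i => pow (p i) 32) l)
    rw [ev_const_add] at h1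
    have h2 := ev_stepsWith_le (P := fun r => ∀ x ∈ S i, r x = 0) (p := p) i 32
      (fun j hj => (hsupp j).imp fun σ hσ r hr x hx => hσ r hr x fun hx' => by
        have := hsep i j hj.symm x hx x hx'
        rw [hd] at this
        linarith) (F := om d (S i)) (fun σ τ υ hτ => om_insert_le hd hd0 (hne i) σ τ υ hτ) l
    have h3 := hoff i (32 * heads i l)
    have h4 : v / 16 / C i * ((32 * heads i l : ℕ) : ℝ) = 2 * v / C i * heads i l := by
      push_cast
      ring
    linarith
  · intro b
    refine All.seqFin (by simp)
      (fun σ τ hσ hτ r hr => (List.mem_append.1 hr).elim (hσ r) (hτ r)) fun i => ?_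
    split_ifs
    · refine All.pow (by simp)
        (fun σ τ hσ hτ r hr => (List.mem_append.1 hr).elim (hσ r) (hτ r)) ?_ 32
      exact (hsupp i).imp fun σ hσ r hr x hx => hσ r hr x fun h => hx (Set.mem_iUnion.2 ⟨i, h⟩)
    · simp [All]
  · rw [ev_pow_node_stepWith]
    exact hC' N

end TaskSystem

namespace CoinTree

theorem ev_count_coin (N : ℕ) : ev (fun l => (l.count true : ℝ)) (pow coin N) = N / 2 := by
  induction N with
  | zero => simp [pow, ev]
  | succ N ih =>
    rw [ev_pow_coin_succ]
    simp only [List.count_cons_self, List.count_cons_of_ne (show false ≠ true by decide),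
      Nat.cast_add, Nat.cast_one]
    rw [ev_add_const, ih]
    ring

/-- The probability that at most `y` out of `T` fair coins show heads. -/
noncomputable def lowProb (T y : ℕ) : ℝ :=
  ev (fun l => if l.count true ≤ y then 1 else 0) (pow coin T)

theorem lowProb_nonneg (T y : ℕ) : 0 ≤ lowProb T y :=
  ev_nonneg (fun l => by split_ifs <;> norm_num) _

theorem lowProb_le_one (T y : ℕ) : lowProb T y ≤ 1 := by
  have := ev_mono (f := fun l : List Bool => if l.count true ≤ y then (1 : ℝ) else 0)
    (g := fun _ => 1) (fun l => by split_ifs <;> norm_num) (pow coin T)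
  rwa [ev_const] at this

end CoinTree

namespace TaskSystem
open CoinTree

/-- The probability that at least one of `m` coins shows heads at most `y` times in `T` tosses. -/
noncomputable def luck (T y m : ℕ) : ℝ := 1 - (1 - lowProb T y) ^ m

theorem luck_nonneg (T y m : ℕ) : 0 ≤ luck T y m := by
  have := lowProb_nonneg T y
  have := lowProb_le_one T y
  have : (1 - lowProb T y) ^ m ≤ 1 := pow_le_one₀ (by linarith) (by linarith)
  unfold luck
  linarith

theorem luck_le_one (T y m : ℕ) : luck T y m ≤ 1 := by
  have := lowProb_le_one T y
  have : 0 ≤ (1 - lowProb T y) ^ m := pow_nonneg (by linarith) _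
  unfold luck
  linarith

variable {m : ℕ}

theorem ev_heads (i : Fin m) (N : ℕ) : ev (fun l => (heads i l : ℝ)) (pow (flips m) N) = N / 2 := by
  have := ev_prod_columns (m := m) N fun j l => if j = i then (l.count true : ℝ) else 1
  simp only [Finset.prod_ite_eq', Finset.mem_univ, if_true] at this
  simp only [heads]
  rw [this, Finset.prod_eq_single i]
  · simp [ev_count_coin]
  · intro j _ hj
    simp [hj, ev_const]
  · simp

/-- Some coin in `I` shows heads at most `y` times. -/
def Lucky (I : Finset (Fin m)) (y : ℕ) (l : List (Fin m → Bool)) : Prop := ∃ i ∈ I, heads i l ≤ y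

theorem ite_lucky (I : Finset (Fin m)) (y : ℕ) (l : List (Fin m → Bool)) :
    (if Lucky I y l then (0 : ℝ) else 1) =
      ∏ i, if i ∈ I then 1 - (if heads i l ≤ y then (1 : ℝ) else 0) else 1 := by
  by_cases h : Lucky I y l
  · obtain ⟨i, hi, hy⟩ := id h
    rw [if_pos h, Finset.prod_eq_zero (Finset.mem_univ i)]
    simp [hi, hy]
  · rw [if_neg h, Finset.prod_eq_one]
    intro i _
    split_ifs with h1 h2
    · exact absurd ⟨i, h1, h2⟩ h
    · simp
    · rfl

theorem ev_unlucky_mul (I : Finset (Fin m)) (T y : ℕ) (g : List Bool → ℝ) {i : Fin m}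
    (hi : i ∉ I) : ev (fun l => (if Lucky I y l then (0 : ℝ) else 1) * g (l.map fun b => b i))
      (pow (flips m) T) = (1 - luck T y I.card) * ev g (pow coin T) := by
  have := ev_prod_columns (m := m) T fun j l =>
    (if j ∈ I then 1 - (if l.count true ≤ y then (1 : ℝ) else 0) else 1) *
      if j = i then g l else 1
  simp only [Finset.prod_mul_distrib, Finset.prod_ite_eq', Finset.mem_univ, if_true] at this
  refine (congrArg (fun f => ev f _) (funext fun l => ?_)).trans (this.trans ?_)
  · rw [ite_lucky]
    rfl
  have h : ∀ j, ev (fun l : List Bool =>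
      (if j ∈ I then 1 - (if l.count true ≤ y then (1 : ℝ) else 0) else 1) *
      if j = i then g l else 1) (pow coin T) =
      (if j ∈ I then 1 - lowProb T y else 1) * if j = i then ev g (pow coin T) else 1 := by
    intro j
    by_cases hj : j = i
    · subst hj
      simp [hi]
    · by_cases hjI : j ∈ I
      · simp only [hj, hjI, if_true, if_false, mul_one]
        have := ev_const_add 1 (fun l : List Bool =>
          (-1 : ℝ) * if l.count true ≤ y then (1 : ℝ) else 0) (pow coin T)
        rw [ev_const_mul] at this
        simp only [neg_mul, one_mul, ← sub_eq_add_neg] at this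
        exact this
      · simp [hj, hjI, ev_const]
  rw [Finset.prod_congr rfl fun j _ => h j, Finset.prod_mul_distrib]
  simp [luck]

/-- The properties of the offline cost of a composed process as a function of its coins. -/
structure ChunkCost (V : List (Fin m → Bool) → ℝ) (v : ℝ) (C : Fin m → ℝ) : Prop where
  append_le : ∀ l l', V (l ++ l') ≤ V l + V l'
  le_append : ∀ l l', V l ≤ V (l ++ l')
  le_heads : ∀ i l, V l ≤ 128 * v + 2 * v / C i * heads i l

variable {V : List (Fin m → Bool) → ℝ} {v : ℝ} {C : Fin m → ℝ}

theorem ChunkCost.ev_le (h : ChunkCost V v C) (i : Fin m) (P : List (Fin m → Bool)) (N : ℕ) :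
    ev (fun l => V (P ++ l)) (pow (flips m) N) ≤
      128 * v + 2 * v / C i * heads i P + v / C i * N := by
  have h1 := ev_mono (f := fun l => V (P ++ l))
    (g := fun l => (128 * v + 2 * v / C i * heads i P) + 2 * v / C i * heads i l)
    (fun l => by
      have := h.le_heads i (P ++ l)
      rw [heads_append] at this
      push_cast at this
      linarith) (pow (flips m) N)
  rw [ev_const_add, ev_const_mul, ev_heads] at h1
  refine h1.trans (le_of_eq ?_)
  ring

theorem ChunkCost.ev_period_le (h : ChunkCost V v C) (hv : 0 ≤ v) {i : Fin m}
    {I : Finset (Fin m)} (hi : i ∉ I) {c : ℝ} (hc : 0 < c) (hI : ∀ j ∈ I, c ≤ C j)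
    (T y T' J : ℕ) (P : List (Fin m → Bool)) :
    ev (fun l => V (P ++ l)) (pow (flips m) (J * T + T')) ≤
      128 * v + 2 * v / C i * heads i P + J * ((1 - luck T y I.card) * (v / C i * T) +
        luck T y I.card * (256 * v + 2 * v / c * y)) + v / C i * T' := by
  induction J generalizing P with
  | zero => simpa using h.ev_le i P T'
  | succ J ih =>
    set Ē := (1 - luck T y I.card) * (v / C i * T) +
        luck T y I.card * (256 * v + 2 * v / c * y) with hE
    have e : (J + 1) * T + T' = T + (J * T + T') := by ring
    rw [e, ev_pow_add]
    set R := J * Ē + v / C i * T' with hR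
    have step : ∀ B : List (Fin m → Bool),
        ev (fun l => V (P ++ (B ++ l))) (pow (flips m) (J * T + T')) ≤
          (128 * v + 2 * v / C i * heads i P + R + (256 * v + 2 * v / c * y)) +
          ((-(256 * v + 2 * v / c * y)) * ((if Lucky I y B then 0 else 1) * 1) +
          2 * v / C i * ((if Lucky I y B then 0 else 1) * heads i B)) := by
      intro B
      split_ifs with hB
      · obtain ⟨j, hj, hy⟩ := hB
        have h1 := ev_mono (f := fun l => V (P ++ (B ++ l)))
          (g := fun l => (V P + V B) + V l) (fun l => by
            have := h.append_le P (B ++ l)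
            have := h.append_le B l
            linarith) (pow (flips m) (J * T + T'))
        rw [ev_const_add] at h1
        have h2 := ih []
        simp only [List.nil_append] at h2
        have h3 := h.le_heads i P
        have h4 : V B ≤ 128 * v + 2 * v / c * y := by
          refine (h.le_heads j B).trans ?_
          have hcj := hI j hj
          have : (heads j B : ℝ) ≤ y := by exact_mod_cast hy
          gcongr
        simp only [heads, List.map_nil, List.count_nil, Nat.cast_zero, mul_zero] at h2
        linarith
      · have := ih (P ++ B)
        rw [heads_append] at this
        push_cast at this
        simp only [List.append_assoc] at this
        linarith
    have h1 := ev_mono step (pow (flips m) T)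
    rw [ev_const_add, ev_add, ev_const_mul, ev_const_mul,
      ev_unlucky_mul I T y (fun _ => 1) hi] at h1
    simp only [heads] at h1
    rw [ev_unlucky_mul I T y (fun l => (l.count true : ℝ)) hi, ev_count_coin, ev_const] at h1
    refine h1.trans (le_of_eq ?_)
    simp only [hR, hE, heads]
    push_cast
    ring

theorem ChunkCost.bound_default (h : ChunkCost V v C) (hv : 0 ≤ v) (i : Fin m) (N : ℕ) :
    ev V (pow (flips m) N) ≤ v / C i * N + 512 * v := by
  have := h.ev_le i [] N
  simp only [List.nil_append, heads, List.map_nil, List.count_nil, Nat.cast_zero] at this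
  linarith

theorem ChunkCost.bound_luck (h : ChunkCost V v C) (hv : 0 ≤ v) {i : Fin m}
    {I : Finset (Fin m)} (hi : i ∉ I) {c : ℝ} (hc : 0 < c) (hI : ∀ j ∈ I, c ≤ C j)
    (hCi : 0 < C i) {T y : ℕ} (hT : 0 < T) (hcond : 384 + 2 * y / c ≤ T / C i) (N : ℕ) :
    ev V (pow (flips m) N) ≤
      v / (C i + 128 * luck T y I.card * C i ^ 2 / T) * N + 512 * v := by
  set p := luck T y I.card with hp
  have hp0 : 0 ≤ p := luck_nonneg _ _ _
  have hp1 : p ≤ 1 := luck_le_one _ _ _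
  have hT' : (0 : ℝ) < T := by exact_mod_cast hT
  have key := h.ev_period_le hv hi hc hI T y (N % T) (N / T) []
  simp only [List.nil_append, heads, List.map_nil, List.count_nil, Nat.cast_zero] at key
  have hN : N / T * T + N % T = N := by rw [mul_comm]; exact Nat.div_add_mod N T
  rw [hN] at key
  have hN' : (N : ℝ) = (N / T : ℕ) * T + (N % T : ℕ) := by exact_mod_cast hN.symm
  have hlt : ((N % T : ℕ) : ℝ) ≤ T := by exact_mod_cast (Nat.mod_lt N hT).le
  set J : ℝ := ((N / T : ℕ) : ℝ)
  set R : ℝ := ((N % T : ℕ) : ℝ)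
  have hJ : 0 ≤ J := Nat.cast_nonneg _
  have hR : 0 ≤ R := Nat.cast_nonneg _
  have hC' : 1 / C i - 128 * p / T ≤ 1 / (C i + 128 * p * C i ^ 2 / T) := by
    rw [le_div_iff₀ (by positivity)]
    have : (1 / C i - 128 * p / T) * (C i + 128 * p * C i ^ 2 / T) =
        1 - (128 * p * C i / T) ^ 2 := by
      field_simp
      ring
    rw [this]
    linarith [sq_nonneg (128 * p * C i / T)]
  have h1 : (1 - p) * (v / C i * T) + p * (256 * v + 2 * v / c * y) ≤
      v * (T / C i - 128 * p) := by
    have : (1 - p) * (v / C i * T) + p * (256 * v + 2 * v / c * y) =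
      v * (T / C i - 128 * p) + v * p * (384 + 2 * y / c - T / C i) := by ring
    rw [this]
    have := mul_nonneg (mul_nonneg hv hp0) (sub_nonneg.2 hcond)
    linarith
  have h2 : v / (C i + 128 * p * C i ^ 2 / T) * N =
      v * (1 / (C i + 128 * p * C i ^ 2 / T) * N) := by ring
  have h3 : (1 / C i - 128 * p / T) * N ≤ 1 / (C i + 128 * p * C i ^ 2 / T) * N :=
    mul_le_mul_of_nonneg_right hC' (Nat.cast_nonneg _)
  have h4 : (1 / C i - 128 * p / T) * N = J * (T / C i - 128 * p) + R / C i - 128 * p * (R / T) := by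
    rw [hN']
    field_simp
    ring
  have h5 : 128 * p * (R / T) ≤ 128 := by
    have : R / T ≤ 1 := (div_le_one hT').2 hlt
    have : p * (R / T) ≤ 1 := mul_le_one₀ hp1 (by positivity) this
    linarith
  have h6 := mul_le_mul_of_nonneg_left h1 hJ
  have h7 := mul_le_mul_of_nonneg_left h3 hv
  have h8 := mul_le_mul_of_nonneg_left h5 hv
  rw [h4] at h7
  have h9 : v / C i * R = v * (R / C i) := by ring
  rw [h2]
  nlinarith

theorem ChunkCost.bound_all_lucky (h : ChunkCost V v C) (hv : 0 ≤ v) {i : Fin m}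
    {I : Finset (Fin m)} (hi : i ∉ I) (hI : ∀ j ∈ I, 0 < C j)
    (hCi : 0 < C i) {T : ℕ} (hT : 0 < T) (hcond : (1 - luck T 0 I.card) * T ≤ 2 * C i) (N : ℕ) :
    ev V (pow (flips m) N) ≤ v / (T / 258) * N + 512 * v := by
  obtain ⟨c, hc, hcI⟩ : ∃ c, 0 < c ∧ ∀ j ∈ I, c ≤ C j := by
    rcases I.eq_empty_or_nonempty with rfl | hne
    · exact ⟨1, one_pos, by simp⟩
    · obtain ⟨j, hj, hmin⟩ := I.exists_min_image C hne
      exact ⟨C j, hI j hj, hmin⟩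
  have hp0 : 0 ≤ luck T 0 I.card := luck_nonneg _ _ _
  have hp1 : luck T 0 I.card ≤ 1 := luck_le_one _ _ _
  have hT' : (0 : ℝ) < T := by exact_mod_cast hT
  have key := h.ev_period_le hv hi hc hcI T 0 0 (N / T + 1) []
  simp only [List.nil_append, heads, List.map_nil, List.count_nil, Nat.cast_zero] at key
  have hN : (N / T + 1) * T + 0 = N + (T - N % T) := by
    have := Nat.div_add_mod N T
    have := Nat.mod_lt N hT
    have : (N / T + 1) * T = T * (N / T) + T := by ring
    omega
  rw [hN, ev_pow_add] at key
  have hmono : ev V (pow (flips m) N) ≤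
      ev (fun σ => ev (fun τ => V (σ ++ τ)) (pow (flips m) (T - N % T))) (pow (flips m) N) := by
    refine ev_mono (fun σ => ?_) _
    have := ev_mono (h.le_append σ) (pow (flips m) (T - N % T))
    rwa [ev_const] at this
  have h1 : (1 - luck T 0 I.card) * (v / C i * T) ≤ 2 * v := by
    have := mul_le_mul_of_nonneg_left hcond (div_nonneg hv hCi.le)
    have e : v / C i * (2 * C i) = 2 * v := by field_simp
    rw [e] at this
    linarith
  have h2 : luck T 0 I.card * (256 * v) ≤ 256 * v := mul_le_of_le_one_left (by linarith) hp1
  have h3 : ((N / T : ℕ) : ℝ) * T ≤ N := by exact_mod_cast Nat.div_mul_le_self N T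
  have h4 : v * 258 * ((N / T : ℕ) : ℝ) ≤ v / (T / 258) * N := by
    have : v / ((T : ℝ) / 258) * N = v * 258 * (N / T) := by field_simp
    rw [this]
    have : ((N / T : ℕ) : ℝ) ≤ N / T := by rwa [le_div_iff₀ hT']
    gcongr
  have h5 : (((N / T : ℕ) : ℝ) + 1) * ((1 - luck T 0 I.card) * (v / C i * T) +
      luck T 0 I.card * (256 * v)) ≤ (((N / T : ℕ) : ℝ) + 1) * (258 * v) := by
    gcongr
    linarith
  push_cast at key
  simp only [mul_zero, add_zero] at key
  linarith

end TaskSystem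

namespace CoinTree

theorem lowProb_mul_le (T T' y y' : ℕ) :
    lowProb T y * lowProb T' y' ≤ lowProb (T + T') (y + y') := by
  unfold lowProb
  rw [ev_pow_add, mul_comm, ← ev_const_mul]
  refine ev_mono (fun σ => ?_) _
  rw [mul_comm, ← ev_const_mul]
  refine ev_mono (fun τ => ?_) _
  rw [List.count_append]
  split_ifs <;> first | omega | simp

theorem lowProb_pow_le (T y L : ℕ) : lowProb T y ^ L ≤ lowProb (L * T) (L * y) := by
  induction L with
  | zero => simp [lowProb, pow, ev]
  | succ L ih =>
    rw [pow_succ, Nat.succ_mul, Nat.succ_mul]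
    exact (mul_le_mul_of_nonneg_right ih (lowProb_nonneg T y)).trans (lowProb_mul_le _ _ _ _)

theorem half_pow_le_lowProb (T : ℕ) : (1 / 2 : ℝ) ^ T ≤ lowProb T 0 := by
  have h : lowProb 1 0 = 1 / 2 := by
    rw [lowProb, ev_pow_coin_succ]
    simp [pow, ev]
  have := lowProb_pow_le 1 0 T
  rwa [h, mul_one, mul_zero] at this

/-- The number of heads minus the number of tails. -/
def excess (l : List Bool) : ℝ := (l.map fun b => if b then (1 : ℝ) else -1).sum

theorem excess_eq (l : List Bool) : excess l = 2 * l.count true - l.length := by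
  induction l with
  | nil => simp [excess]
  | cons b l ih =>
    simp only [excess, List.map_cons, List.sum_cons] at ih ⊢
    rw [ih]
    cases b <;> simp <;> ring

theorem ev_excess_sq (N : ℕ) : ev (fun l => excess l ^ 2) (pow coin N) = N := by
  induction N with
  | zero => simp [pow, ev, excess]
  | succ N ih =>
    have h : ∀ l : List Bool, excess (true :: l) ^ 2 + excess (false :: l) ^ 2 =
        2 + 2 * excess l ^ 2 := fun l => by
      simp only [excess, List.map_cons, List.sum_cons, if_true, Bool.false_eq_true, if_false]
      ring
    rw [ev_pow_coin_succ, ← ev_add]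
    simp only [h]
    rw [ev_const_add, ev_const_mul, ih]
    push_cast
    ring

theorem ev_excess_pow_four (N : ℕ) :
    ev (fun l => excess l ^ 4) (pow coin N) = 3 * (N : ℝ) ^ 2 - 2 * N := by
  induction N with
  | zero => simp [pow, ev, excess]
  | succ N ih =>
    have h : ∀ l : List Bool, excess (true :: l) ^ 4 + excess (false :: l) ^ 4 =
        2 + (12 * excess l ^ 2 + 2 * excess l ^ 4) := fun l => by
      simp only [excess, List.map_cons, List.sum_cons, if_true, Bool.false_eq_true, if_false]
      ring
    rw [ev_pow_coin_succ, ← ev_add]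
    simp only [h]
    rw [ev_const_add, ev_add, ev_const_mul, ev_const_mul, ih, ev_excess_sq]
    push_cast
    ring

theorem ev_map_not (F : List Bool → ℝ) (N : ℕ) :
    ev (fun l => F (l.map not)) (pow coin N) = ev F (pow coin N) := by
  induction N generalizing F with
  | zero => simp [pow, ev]
  | succ N ih =>
    rw [ev_pow_coin_succ, ev_pow_coin_succ]
    simp only [List.map_cons, Bool.not_true, Bool.not_false]
    rw [ih fun l => F (true :: l), ih fun l => F (false :: l), add_comm]

theorem excess_map_not (l : List Bool) : excess (l.map not) = -excess l := by
  induction l with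
  | nil => simp [excess]
  | cons b l ih =>
    simp only [excess, List.map_cons, List.sum_cons] at ih ⊢
    rw [ih]
    cases b <;> simp <;> ring

theorem all_length_coin (N : ℕ) : All (fun l => l.length = N) (pow coin N) := by
  induction N with
  | zero => exact rfl
  | succ N ih =>
    exact All.seq (P := fun l => l.length = 1) (Q := fun l => l.length = N)
      (fun σ τ hσ hτ => by simp [hσ, hτ, add_comm]) (fun b => rfl) ih

theorem le_lowProb (g : ℕ) (hg : 0 < g) :
    (3 / 32 : ℝ) ≤ lowProb (16 * g ^ 2) (8 * g ^ 2 - g) := by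
  set N := 16 * g ^ 2 with hN
  have hg' : (0 : ℝ) < g := by exact_mod_cast hg
  have hgg : g ≤ 8 * g ^ 2 := by nlinarith
  set I : List Bool → ℝ := fun l => if excess l ≤ -(2 * g) then 1 else 0 with hI
  have h1 : ev I (pow coin N) = lowProb N (8 * g ^ 2 - g) := by
    refine le_antisymm ?_ ?_ <;>
    · refine ev_mono_of_all (P := fun l => l.length = N) (fun l hl => ?_) (all_length_coin N)
      have : excess l ≤ -(2 * g) ↔ l.count true ≤ 8 * g ^ 2 - g := by
        rw [excess_eq, hl, ← @Nat.cast_le ℝ, Nat.cast_sub hgg, hN]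
        push_cast
        constructor <;> intro h <;> linarith
      simp only [hI, this]
      exact le_rfl
  have h2 : ev (fun l => I (l.map not)) (pow coin N) = lowProb N (8 * g ^ 2 - g) := by
    rw [ev_map_not, h1]
  have h3 : ∀ l, -(1 / 8) + (1 / (32 * g ^ 2) * excess l ^ 2 +
      (-(1 / (4096 * g ^ 4))) * excess l ^ 4) ≤ I l + I (l.map not) := by
    intro l
    simp only [hI, excess_map_not]
    set x := excess l
    have e : -(1 / 8) + (1 / (32 * (g : ℝ) ^ 2) * x ^ 2 + (-(1 / (4096 * (g : ℝ) ^ 4))) * x ^ 4) =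
      7 / 8 - (x ^ 2 / (64 * g ^ 2) - 1) ^ 2 := by
      field_simp
      ring
    rw [e]
    by_cases h : x ≤ -(2 * g)
    · rw [if_pos h]
      have : (0 : ℝ) ≤ if -x ≤ -(2 * g) then 1 else 0 := by split_ifs <;> norm_num
      nlinarith [sq_nonneg (x ^ 2 / (64 * g ^ 2) - 1)]
    · rw [if_neg h]
      by_cases h' : -x ≤ -(2 * g)
      · rw [if_pos h']
        nlinarith [sq_nonneg (x ^ 2 / (64 * g ^ 2) - 1)]
      · rw [if_neg h']
        push Not at h h'
        have hx : x ^ 2 ≤ 4 * g ^ 2 := by nlinarith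
        have : x ^ 2 / (64 * g ^ 2) ≤ 1 / 16 := by
          rw [div_le_iff₀ (by positivity)]
          linarith
        nlinarith
  have h4 := ev_mono h3 (pow coin N)
  rw [ev_const_add, ev_add, ev_add, ev_const_mul, ev_const_mul, ev_excess_sq, ev_excess_pow_four,
    h1, h2, hN] at h4
  push_cast at h4
  have e : -(1 / 8) + (1 / (32 * (g : ℝ) ^ 2) * (16 * g ^ 2) +
      (-(1 / (4096 * (g : ℝ) ^ 4))) * (3 * (16 * g ^ 2) ^ 2 - 2 * (16 * g ^ 2))) =
      3 / 16 + 1 / (128 * g ^ 2) := by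
    field_simp
    ring
  rw [e] at h4
  have : (0 : ℝ) < 1 / (128 * g ^ 2) := by positivity
  linarith

theorem pow_le_lowProb (g L : ℕ) (hg : 0 < g) :
    (3 / 32 : ℝ) ^ L ≤ lowProb (L * (16 * g ^ 2)) (L * (8 * g ^ 2 - g)) :=
  (pow_le_pow_left₀ (by norm_num) (le_lowProb g hg) L).trans (lowProb_pow_le _ _ _)

end CoinTree

namespace TaskSystem
open CoinTree

theorem lowProb_le_luck {T y k : ℕ} (hk : k ≠ 0) : lowProb T y ≤ luck T y k := by
  have h0 := lowProb_nonneg T y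
  have h1 := lowProb_le_one T y
  have := pow_le_of_le_one (a := 1 - lowProb T y) (by linarith) (by linarith) hk
  unfold luck
  linarith

theorem one_sub_luck_mul_le (T y k : ℕ) : (1 - luck T y k) * (1 + k * lowProb T y) ≤ 1 := by
  have h0 := lowProb_nonneg T y
  have h1 := lowProb_le_one T y
  unfold luck
  rw [sub_sub_cancel]
  have h2 : 1 + k * lowProb T y ≤ (1 + lowProb T y) ^ k :=
    one_add_mul_le_pow (by linarith) k
  have h3 : 0 ≤ (1 - lowProb T y) ^ k := pow_nonneg (by linarith) k
  calc (1 - lowProb T y) ^ k * (1 + k * lowProb T y)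
      ≤ (1 - lowProb T y) ^ k * (1 + lowProb T y) ^ k := by gcongr
    _ = (1 - lowProb T y ^ 2) ^ k := by rw [← mul_pow]; ring
    _ ≤ 1 := pow_le_one₀ (by nlinarith) (by nlinarith)

theorem half_le_luck {T y k : ℕ} (h : 1 ≤ k * lowProb T y) : 1 / 2 ≤ luck T y k := by
  have h1 := one_sub_luck_mul_le T y k
  have h2 := luck_le_one T y k
  nlinarith

variable {m : ℕ} {V : List (Fin m → Bool) → ℝ} {v : ℝ} {C : Fin m → ℝ}

theorem ChunkCost.gain (h : ChunkCost V v C) (hv : 0 ≤ v) {i : Fin m} {I : Finset (Fin m)}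
    (hi : i ∉ I) {c : ℝ} (hc : 0 < c) (hI : ∀ j ∈ I, c ≤ C j) (hCi : 0 < C i) (hci : c ≤ C i)
    {L : ℕ} (hL : 0 < L) (hLC : L ≤ 384 * C i) (hΔ : C i - c ≤ L / 12288) :
    ∃ T y, (3 / 32 : ℝ) ^ L ≤ lowProb T y ∧ ∃ C', C i + luck T y I.card * L / 73728 ≤ C' ∧
      ∀ N : ℕ, ev V (pow (flips m) N) ≤ v / C' * N + 512 * v := by
  have hL' : (0 : ℝ) < L := by exact_mod_cast hL
  set g := ⌈384 * C i / L⌉₊ with hg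
  have hg1 : 384 * C i / L ≤ g := Nat.le_ceil _
  have hg0 : (0 : ℝ) < g := lt_of_lt_of_le (by positivity) hg1
  have hg0' : 0 < g := by exact_mod_cast hg0
  have hgg : g ≤ 8 * g ^ 2 := by nlinarith
  have hone : 1 ≤ 384 * C i / L := by rwa [le_div_iff₀ hL', one_mul]
  have hg2 : (g : ℝ) ≤ 768 * C i / L := by
    have := (Nat.ceil_lt_add_one (show 0 ≤ 384 * C i / L by positivity)).le
    have e : 768 * C i / L = 384 * C i / L + 384 * C i / L := by ring
    rw [e]
    linarith
  rw [div_le_iff₀ hL'] at hg1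
  rw [le_div_iff₀ hL'] at hg2
  have hT : 0 < L * (16 * g ^ 2) := by positivity
  refine ⟨L * (16 * g ^ 2), L * (8 * g ^ 2 - g), pow_le_lowProb g L hg0',
    C i + 128 * luck (L * (16 * g ^ 2)) (L * (8 * g ^ 2 - g)) I.card * C i ^ 2 /
      (L * (16 * g ^ 2) : ℕ), ?_, fun N => h.bound_luck hv hi hc hI hCi hT ?_ N⟩
  · have h0 := luck_nonneg (L * (16 * g ^ 2)) (L * (8 * g ^ 2 - g)) I.card
    set p := luck (L * (16 * g ^ 2)) (L * (8 * g ^ 2 - g)) I.card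
    have : (L : ℝ) / 73728 ≤ 128 * C i ^ 2 / (L * (16 * g ^ 2) : ℕ) := by
      rw [div_le_div_iff₀ (by norm_num) (by exact_mod_cast hT)]
      push_cast
      have : (g * L : ℝ) ^ 2 ≤ (768 * C i) ^ 2 := by gcongr
      nlinarith
    have := mul_le_mul_of_nonneg_left this h0
    have e : 128 * p * C i ^ 2 / (L * (16 * g ^ 2) : ℕ) =
      p * (128 * C i ^ 2 / (L * (16 * g ^ 2) : ℕ)) := by ring
    rw [e, mul_div_assoc]
    linarith
  · push_cast [Nat.cast_sub hgg]
    rw [← le_sub_iff_add_le]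
    have e : (L * (16 * g ^ 2) : ℝ) / C i - 2 * (L * (8 * g ^ 2 - g)) / c =
      (2 * L * g - 16 * (L * g) * g * (C i - c) / C i) / c := by
      field_simp
      ring
    rw [e, le_div_iff₀ hc]
    have h1 : 16 * (L * g) * g * (C i - c) / C i ≤ L * g := by
      rw [div_le_iff₀ hCi]
      have a1 : 16 * (L * g) * g * (C i - c) ≤ 16 * (L * g) * g * (L / 12288) := by gcongr
      have a2 : 16 * (L * g) * g * (L / 12288) = (L * g) * (g * L) * (16 / 12288 : ℝ) := by ring
      have a3 : (L * g) * (g * L) * (16 / 12288 : ℝ) ≤ (L * g) * (768 * C i) * (16 / 12288 : ℝ) := by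
        gcongr
      linarith
    nlinarith

theorem ChunkCost.gain_zero (h : ChunkCost V v C) (hv : 0 ≤ v) {i j : Fin m} (hij : i ≠ j)
    (hCi : 1 ≤ C i) (hCj : 0 < C j) :
    ∃ C', C i + Real.exp (-(385 * C i)) / 4 ≤ C' ∧
      ∀ N : ℕ, ev V (pow (flips m) N) ≤ v / C' * N + 512 * v := by
  set T := ⌈384 * C i⌉₊ with hT
  have hT1 : 384 * C i ≤ T := Nat.le_ceil _
  have hT2 : (T : ℝ) ≤ 385 * C i := by
    have := (Nat.ceil_lt_add_one (show 0 ≤ 384 * C i by linarith)).le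
    linarith
  have hT0 : (0 : ℝ) < T := by linarith
  have hT0' : 0 < T := by exact_mod_cast hT0
  refine ⟨_, ?_, h.bound_luck hv (I := {j}) (by simpa using hij) hCj (by simp) (by linarith) hT0'
    (y := 0) ?_⟩
  · have h1 : Real.exp (-(385 * C i)) ≤ luck T 0 (Finset.card {j}) := by
      refine le_trans ?_ ((half_pow_le_lowProb T).trans (lowProb_le_luck (by simp)))
      have : Real.exp (-1) ≤ 1 / 2 := by
        rw [Real.exp_neg, one_div]
        exact inv_anti₀ (by norm_num) (by linarith [Real.exp_one_gt_d9])
      calc Real.exp (-(385 * C i)) ≤ Real.exp (T * (-1)) := by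
            apply Real.exp_le_exp.2
            linarith
        _ = Real.exp (-1) ^ T := by rw [Real.exp_nat_mul]
        _ ≤ (1 / 2) ^ T := by gcongr
    have h2 : (1 : ℝ) / 4 ≤ 128 * C i ^ 2 / T := by
      rw [div_le_div_iff₀ (by norm_num) hT0]
      nlinarith
    have h3 := mul_le_mul h1 h2 (by norm_num) (luck_nonneg _ _ _)
    have e : 128 * luck T 0 (Finset.card {j}) * C i ^ 2 / T =
      luck T 0 (Finset.card {j}) * (128 * C i ^ 2 / T) := by ring
    rw [e]
    linarith
  · rw [le_div_iff₀ (by linarith)]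
    simpa using hT1

theorem ChunkCost.gain_many (h : ChunkCost V v C) (hv : 0 ≤ v) {i : Fin m} {I : Finset (Fin m)}
    (hi : i ∉ I) (hI : ∀ j ∈ I, 0 < C j) (hCi : 1 ≤ C i) {T : ℕ} (hT : 0 < T)
    (hTI : T * 2 ^ T ≤ 2 * I.card) (N : ℕ) :
    ev V (pow (flips m) N) ≤ v / (T / 258) * N + 512 * v := by
  refine h.bound_all_lucky hv hi hI (by linarith) hT ?_ N
  have h1 := one_sub_luck_mul_le T 0 I.card
  have h2 := luck_le_one T 0 I.card
  have h3 : (T : ℝ) / 2 ≤ I.card * lowProb T 0 := by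
    have a1 : (T : ℝ) * 2 ^ T ≤ 2 * I.card := by exact_mod_cast hTI
    have a2 := mul_le_mul_of_nonneg_left (half_pow_le_lowProb T) (Nat.cast_nonneg (α := ℝ) I.card)
    refine le_trans ?_ a2
    rw [one_div, inv_pow, ← div_eq_mul_inv, div_le_div_iff₀ (by norm_num) (by positivity)]
    linarith
  have h4 : (1 - luck T 0 I.card) * (1 + T / 2) ≤ 1 :=
    (mul_le_mul_of_nonneg_left (by linarith) (by linarith)).trans h1
  nlinarith

end TaskSystem

namespace TaskSystem
open CoinTree

theorem sum_sqrt_le {ι : Type*} {n : ι → ℝ} {N : ℝ} {J : Finset ι}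
    (h : ∀ I ⊆ J, I.Nonempty → ∃ j ∈ I, n j * (I.card + 1) ^ 4 ≤ N) :
    ∑ i ∈ J, √(n i) ≤ √N * (1 - 1 / (J.card + 1)) := by
  induction hk : J.card generalizing J with
  | zero => simp [Finset.card_eq_zero.1 hk]
  | succ k ih =>
    obtain ⟨j, hj, hjN⟩ := h J subset_rfl (Finset.card_pos.1 (by omega))
    have hc : (J.erase j).card = k := by rw [Finset.card_erase_of_mem hj, hk]; rfl
    have h1 := ih (J := J.erase j)
      (fun I hI hI' => h I (hI.trans (Finset.erase_subset _ _)) hI') hc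
    rw [← Finset.add_sum_erase J _ hj]
    have h2 : √(n j) ≤ √N * (1 / ((k : ℝ) + 2) ^ 2) := by
      rw [mul_one_div, le_div_iff₀ (by positivity)]
      rw [hk] at hjN
      push_cast at hjN
      have : √(n j) * ((k : ℝ) + 2) ^ 2 = √(n j * (k + 1 + 1) ^ 4) := by
        rw [Real.sqrt_mul' _ (by positivity)]
        congr 1
        symm
        rw [Real.sqrt_eq_iff_mul_self_eq (by positivity) (by positivity)]
        ring
      rw [this]
      exact Real.sqrt_le_sqrt hjN
    have h3 : 1 / ((k : ℝ) + 2) ^ 2 ≤ 1 / (k + 1) - 1 / (k + 2) := by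
      have : (1 : ℝ) / (k + 1) - 1 / (k + 2) = 1 / ((k + 1) * (k + 2)) := by
        field_simp
        ring
      rw [this]
      apply one_div_le_one_div_of_le (by positivity)
      nlinarith [(Nat.cast_nonneg k : (0 : ℝ) ≤ k)]
    have h4 := mul_le_mul_of_nonneg_left h3 (Real.sqrt_nonneg N)
    push_cast
    have e : (k : ℝ) + 1 + 1 = k + 2 := by ring
    rw [e]
    linarith

theorem exp_neg_three_le : Real.exp (-3) ≤ 3 / 32 := by
  have h : Real.exp 3 = Real.exp 1 ^ 3 := by rw [← Real.exp_nat_mul]; norm_num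
  have h1 : (2.7 : ℝ) ^ 3 ≤ Real.exp 1 ^ 3 :=
    pow_le_pow_left₀ (by norm_num) (by linarith [Real.exp_one_gt_d9]) 3
  rw [Real.exp_neg, inv_le_comm₀ (Real.exp_pos _) (by norm_num), h]
  norm_num at h1 ⊢
  linarith

theorem exp_le_three_div_pow (L : ℕ) : Real.exp (-(3 * L)) ≤ (3 / 32 : ℝ) ^ L := by
  have : -(3 * (L : ℝ)) = L * (-3) := by ring
  rw [this, Real.exp_nat_mul]
  exact pow_le_pow_left₀ (Real.exp_pos _).le exp_neg_three_le L

/-- The constant relating the logarithm of the size of a tree to the competitive ratio. -/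
noncomputable def rate : ℝ := 1 / 10 ^ 8

theorem rate_pos : 0 < rate := by
  unfold rate
  norm_num

variable {m : ℕ} {V : List (Fin m → Bool) → ℝ} {v : ℝ} {n : Fin m → ℝ}

theorem ChunkCost.combine_many (h : ChunkCost V v fun i => 1 + rate * Real.log (n i)) (hv : 0 ≤ v)
    (hn : ∀ i, 1 ≤ n i) {i : Fin m} {I : Finset (Fin m)} (hi : i ∉ I) (hI : I.Nonempty)
    {a N : ℝ} (ha : 1 ≤ a) (haI : ∀ j ∈ I, a ≤ n j) (hai : a ≤ n i) (hiN : n i ≤ N)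
    (haN : N ≤ a * (I.card + 1) ^ 4) :
    ∃ C', 1 + rate * Real.log N ≤ C' ∧
      ∀ k : ℕ, ev V (pow (flips m) k) ≤ v / C' * k + 512 * v := by
  set C := fun i => 1 + rate * Real.log (n i) with hC
  have hk : 1 ≤ I.card := hI.card_pos
  have hkR : (1 : ℝ) ≤ I.card := by exact_mod_cast hk
  set l := Real.log (I.card + 1) with hl
  have hl0 : 0 < l := Real.log_pos (by linarith)
  have hel : Real.exp l = I.card + 1 := Real.exp_log (by linarith)
  have hpos := rate_pos
  have hlogN : Real.log N ≤ Real.log a + 4 * l := by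
    have := Real.log_le_log (by linarith) haN
    rw [Real.log_mul (by linarith) (by positivity), Real.log_pow] at this
    push_cast at this
    exact this
  have hloga : 0 ≤ Real.log a := Real.log_nonneg ha
  have hlogai : Real.log a ≤ Real.log (n i) := Real.log_le_log (by linarith) hai
  have hlogiN : Real.log (n i) ≤ Real.log N := Real.log_le_log (by linarith [hn i]) hiN
  have hC1 : ∀ j, 1 ≤ C j := fun j => by
    have := Real.log_nonneg (hn j)
    simp only [hC]
    nlinarith
  have hneed : 1 + rate * Real.log N ≤ C i + 4 * rate * l := by
    simp only [hC]
    nlinarith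
  have hcI : ∀ j ∈ I, 1 + rate * Real.log a ≤ C j := fun j hj => by
    have := Real.log_le_log (by linarith) (haI j hj)
    simp only [hC]
    nlinarith
  have hc0 : 0 < 1 + rate * Real.log a := by positivity
  have hci : 1 + rate * Real.log a ≤ C i := by
    simp only [hC]
    nlinarith
  have hΔ : C i - (1 + rate * Real.log a) ≤ 4 * rate * l := by
    simp only [hC]
    nlinarith
  by_cases hcase : 2064 * C i ≤ l
  · have hlbig : 2064 ≤ l := by linarith [hC1 i]
    set T := ⌊l / 2⌋₊ with hT
    have hT1 : (T : ℝ) ≤ l / 2 := Nat.floor_le (by linarith)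
    have hT2 : l / 2 < T + 1 := Nat.lt_floor_add_one _
    have hT0 : 0 < T := by
      have : (0 : ℝ) < T := by linarith
      exact_mod_cast this
    refine ⟨T / 258, ?_, fun k => h.gain_many hv hi (fun j _ => by linarith [hC1 j]) (hC1 i) hT0
      ?_ k⟩
    · have : rate = 1 / 10 ^ 8 := rfl
      rw [this] at hneed ⊢
      linarith
    · have h1 : T * 2 ^ T ≤ 4 ^ T := by
        calc T * 2 ^ T ≤ 2 ^ T * 2 ^ T := by
              gcongr
              exact Nat.lt_two_pow_self.le
          _ = 4 ^ T := by rw [← mul_pow]; norm_num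
      have h2 : (4 : ℝ) ^ T ≤ I.card + 1 := by
        have : (4 : ℝ) ≤ Real.exp 2 := by
          have e : Real.exp 2 = Real.exp 1 ^ 2 := by rw [← Real.exp_nat_mul]; norm_num
          rw [e]
          nlinarith [Real.exp_one_gt_d9]
        calc (4 : ℝ) ^ T ≤ Real.exp 2 ^ T := by gcongr
          _ = Real.exp (T * 2) := by rw [Real.exp_nat_mul]
          _ ≤ Real.exp l := Real.exp_le_exp.2 (by linarith)
          _ = I.card + 1 := hel
      have h3 : 4 ^ T ≤ I.card + 1 := by exact_mod_cast h2
      omega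
  · push Not at hcase
    by_cases h6 : 6 ≤ l
    · set L := ⌊l / 6⌋₊ with hL
      have hL1 : (L : ℝ) ≤ l / 6 := Nat.floor_le (by linarith)
      have hL2 : l / 6 < L + 1 := Nat.lt_floor_add_one _
      have hL0 : 1 ≤ L := Nat.le_floor (by push_cast; linarith)
      have hL0' : (1 : ℝ) ≤ L := by exact_mod_cast hL0
      obtain ⟨T, y, hp, C', hC', hb⟩ := h.gain hv hi hc0 hcI (by linarith [hC1 i]) hci hL0
        (by linarith [hC1 i]) (by
          have : rate = 1 / 10 ^ 8 := rfl
          rw [this] at hΔ ⊢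
          linarith)
      refine ⟨C', ?_, hb⟩
      have hluck : 1 / 2 ≤ luck T y I.card := by
        apply half_le_luck
        have h1 := (exp_le_three_div_pow L).trans hp
        have h2 : Real.exp (-(l / 2)) ≤ Real.exp (-(3 * L)) := Real.exp_le_exp.2 (by linarith)
        have h3 : 1 ≤ I.card * Real.exp (-(l / 2)) := by
          have e : (I.card : ℝ) = Real.exp (l / 2) ^ 2 - 1 := by
            rw [← Real.exp_nat_mul]
            push_cast
            rw [mul_div_cancel₀ _ (by norm_num : (2 : ℝ) ≠ 0), hel]
            ring
          have h4 : 4 ≤ Real.exp (l / 2) := by linarith [Real.add_one_le_exp (l / 2)]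
          rw [Real.exp_neg, ← div_eq_mul_inv, le_div_iff₀ (Real.exp_pos _), e]
          nlinarith
        exact h3.trans (mul_le_mul_of_nonneg_left (h2.trans h1) (by positivity))
      have : rate = 1 / 10 ^ 8 := rfl
      rw [this] at hneed ⊢
      nlinarith
    · push Not at h6
      obtain ⟨T, y, hp, C', hC', hb⟩ := h.gain (L := 1) hv hi hc0 hcI (by linarith [hC1 i]) hci
        one_pos (by push_cast; linarith [hC1 i]) (by
          have : rate = 1 / 10 ^ 8 := rfl
          rw [this] at hΔ ⊢
          push_cast
          linarith)
      refine ⟨C', ?_, hb⟩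
      have := hp.trans (lowProb_le_luck (T := T) (y := y) (k := I.card) (by omega))
      have e : rate = 1 / 10 ^ 8 := rfl
      rw [e] at hneed ⊢
      push_cast at hC'
      linarith

theorem ChunkCost.combine_two (h : ChunkCost V v fun i => 1 + rate * Real.log (n i)) (hv : 0 ≤ v)
    (hn : ∀ i, 1 ≤ n i) {i j : Fin m} (hij : i ≠ j) (hji : n j ≤ n i) :
    ∃ C', 1 + rate * Real.log (n i) + 2 * rate * √(n j / n i) ≤ C' ∧
      ∀ k : ℕ, ev V (pow (flips m) k) ≤ v / C' * k + 512 * v := by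
  set C := fun i => 1 + rate * Real.log (n i) with hC
  have hpos := rate_pos
  have hC1 : ∀ j, 1 ≤ C j := fun j => by
    have := Real.log_nonneg (hn j)
    simp only [hC]
    nlinarith
  have hi0 : 0 < n i := by linarith [hn i]
  have hj0 : 0 < n j := by linarith [hn j]
  set t := Real.log (n i / n j) with ht
  have ht0 : 0 ≤ t := Real.log_nonneg (by rwa [le_div_iff₀ hj0, one_mul])
  have hq : √(n j / n i) = Real.exp (-(t / 2)) := by
    rw [Real.sqrt_eq_iff_mul_self_eq (by positivity) (Real.exp_pos _).le, ← Real.exp_add]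
    have : -(t / 2) + -(t / 2) = -t := by ring
    rw [this, Real.exp_neg, ht, Real.exp_log (by positivity), inv_div]
  rw [hq]
  change ∃ C', C i + 2 * rate * Real.exp (-(t / 2)) ≤ C' ∧ _
  have hΔ : C i - C j = rate * t := by
    simp only [hC, ht]
    rw [Real.log_div hi0.ne' hj0.ne']
    ring
  have hrt : 0 ≤ rate * t := by positivity
  have e : rate = 1 / 10 ^ 8 := rfl
  by_cases hcase : 12288 * (rate * t) ≤ 383 * C i
  · have hL1 : 12288 * (rate * t) ≤ ⌈12288 * (rate * t)⌉₊ := Nat.le_ceil _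
    have hL2 := (Nat.ceil_lt_add_one (show 0 ≤ 12288 * (rate * t) by positivity)).le
    by_cases hsmall : 12288 * (rate * t) ≤ 1
    · obtain ⟨T, y, hp, C', hC', hb⟩ := h.gain (L := 1) (I := {j}) hv (by simpa using hij)
        (c := C j) (by linarith [hC1 j]) (by simp) (by linarith [hC1 i]) (by linarith)
        one_pos (by push_cast; linarith [hC1 i]) (by rw [hΔ]; push_cast; linarith)
      refine ⟨C', ?_, hb⟩
      have h1 := hp.trans (lowProb_le_luck (T := T) (y := y) (k := Finset.card {j}) (by simp))
      have h2 : Real.exp (-(t / 2)) ≤ 1 := Real.exp_le_one_iff.2 (by linarith)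
      rw [e] at *
      push_cast at hC'
      linarith
    · push Not at hsmall
      set L := ⌈12288 * (rate * t)⌉₊ with hL
      have hL0 : 0 < L := by
        have : (0 : ℝ) < L := by linarith
        exact_mod_cast this
      have hL0' : (1 : ℝ) ≤ L := by exact_mod_cast hL0
      obtain ⟨T, y, hp, C', hC', hb⟩ := h.gain (L := L) (I := {j}) hv (by simpa using hij)
        (c := C j) (by linarith [hC1 j]) (by simp) (by linarith [hC1 i]) (by linarith)
        hL0 (by linarith [hC1 i]) (by rw [hΔ]; linarith)
      refine ⟨C', ?_, hb⟩
      have h1 := hp.trans (lowProb_le_luck (T := T) (y := y) (k := Finset.card {j}) (by simp))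
      have h2 : Real.exp (-(t / 2)) / 25 ≤ (3 / 32 : ℝ) ^ L := by
        refine le_trans ?_ (exp_le_three_div_pow L)
        have h3 : Real.exp (-(t / 2)) * Real.exp (-3) ≤ Real.exp (-(3 * L)) := by
          rw [← Real.exp_add]
          apply Real.exp_le_exp.2
          rw [e] at hL2
          linarith
        have h4 : (1 : ℝ) / 25 ≤ Real.exp (-3) := by
          have h5 : Real.exp 3 = Real.exp 1 ^ 3 := by rw [← Real.exp_nat_mul]; norm_num
          rw [Real.exp_neg, one_div]
          apply inv_anti₀ (Real.exp_pos _)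
          rw [h5]
          calc Real.exp 1 ^ 3 ≤ 2.8 ^ 3 :=
              pow_le_pow_left₀ (Real.exp_pos _).le (by linarith [Real.exp_one_lt_d9]) 3
            _ ≤ 25 := by norm_num
        have := mul_le_mul_of_nonneg_left h4 (Real.exp_pos (-(t / 2))).le
        linarith
      have h6 := Real.exp_pos (-(t / 2))
      have h7 : luck T y (Finset.card {j}) * 1 ≤ luck T y (Finset.card {j}) * L := by
        gcongr
        exact luck_nonneg _ _ _
      rw [e] at *
      linarith
  · push Not at hcase
    obtain ⟨C', hC', hb⟩ := h.gain_zero hv hij (hC1 i) (by linarith [hC1 j])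
    refine ⟨C', ?_, hb⟩
    have h1 : Real.exp (-(t / 2)) ≤ Real.exp (-(385 * C i)) := by
      apply Real.exp_le_exp.2
      rw [e] at *
      linarith
    have h6 := Real.exp_pos (-(t / 2))
    rw [e] at *
    linarith

theorem ChunkCost.combine {m : ℕ} {V : List (Fin (m + 1) → Bool) → ℝ} {n : Fin (m + 1) → ℝ}
    (h : ChunkCost V v fun i => 1 + rate * Real.log (n i)) (hv : 0 ≤ v) (hn : ∀ i, 1 ≤ n i) :
    ∃ C', 1 + rate * Real.log (∑ i, n i) ≤ C' ∧
      ∀ k : ℕ, ev V (pow (flips (m + 1)) k) ≤ v / C' * k + 512 * v := by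
  obtain ⟨i, -, hi⟩ := Finset.univ.exists_max_image n Finset.univ_nonempty
  have hi' : ∀ j, n j ≤ n i := fun j => hi j (Finset.mem_univ j)
  have hn0 : ∀ j, 0 ≤ n j := fun j => by linarith [hn j]
  set N := ∑ i, n i with hN
  have hiN : n i ≤ N := Finset.single_le_sum (fun j _ => hn0 j) (Finset.mem_univ i)
  by_cases hA : ∀ I ⊆ Finset.univ.erase i, I.Nonempty → ∃ j ∈ I, n j * (I.card + 1) ^ 4 ≤ N
  · rcases (Finset.univ.erase i).eq_empty_or_nonempty with he | hne
    · refine ⟨1 + rate * Real.log (n i), ?_, h.bound_default hv i⟩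
      rw [hN, ← Finset.add_sum_erase _ _ (Finset.mem_univ i), he]
      simp
    · obtain ⟨j, hj, hjmax⟩ := (Finset.univ.erase i).exists_max_image n hne
      have hij : i ≠ j := (Finset.ne_of_mem_erase hj).symm
      obtain ⟨C', hC', hb⟩ := h.combine_two hv hn hij (hi' j)
      refine ⟨C', le_trans ?_ hC', hb⟩
      have hN0 : 0 < N := by linarith [hn i]
      have h1 := sum_sqrt_le hA
      have h2 : N - n i ≤ √(n j) * √N := by
        have : N - n i = ∑ k ∈ Finset.univ.erase i, n k := by
          rw [hN, ← Finset.add_sum_erase _ _ (Finset.mem_univ i)]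
          ring
        rw [this]
        calc ∑ k ∈ Finset.univ.erase i, n k
            ≤ ∑ k ∈ Finset.univ.erase i, √(n j) * √(n k) := by
              refine Finset.sum_le_sum fun k hk => ?_
              nth_rewrite 1 [← Real.mul_self_sqrt (hn0 k)]
              gcongr
              exact hjmax k hk
          _ = √(n j) * ∑ k ∈ Finset.univ.erase i, √(n k) := by rw [Finset.mul_sum]
          _ ≤ √(n j) * √N := by
              gcongr
              refine h1.trans (mul_le_of_le_one_right (Real.sqrt_nonneg _) ?_)
              have : (0 : ℝ) ≤ 1 / (((Finset.univ.erase i).card : ℝ) + 1) := by positivity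
              linarith
      have h3 : n j * 16 ≤ N := by
        obtain ⟨k, hk, hkN⟩ := hA {j} (by simpa using hij.symm) (by simp)
        rw [Finset.mem_singleton] at hk
        subst hk
        norm_num at hkN
        exact hkN
      have h4 : √(n j) * √N ≤ N / 4 := by
        rw [← Real.sqrt_mul (hn0 j)]
        apply Real.sqrt_le_iff.2
        constructor <;> nlinarith
      have h5 : √N ≤ 2 * √(n i) := by
        rw [show (2 : ℝ) = √4 by rw [show (4 : ℝ) = 2 ^ 2 by norm_num]; simp,
          ← Real.sqrt_mul (by norm_num)]
        exact Real.sqrt_le_sqrt (by linarith)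
      have hi0 : 0 < n i := by linarith [hn i]
      have h6 : Real.log N - Real.log (n i) ≤ 2 * √(n j / n i) := by
        rw [← Real.log_div (by linarith) hi0.ne']
        refine (Real.log_le_sub_one_of_pos (div_pos hN0 hi0)).trans ?_
        rw [Real.sqrt_div (hn0 j)]
        have : N / n i - 1 = (N - n i) / n i := by field_simp
        rw [this, div_le_iff₀ hi0]
        have e : 2 * (√(n j) / √(n i)) * n i = √(n j) * (2 * √(n i)) := by
          nth_rewrite 2 [← Real.mul_self_sqrt hi0.le]
          have : √(n i) ≠ 0 := (Real.sqrt_pos.2 hi0).ne'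
          field_simp
        rw [e]
        exact h2.trans (by gcongr)
      have := mul_le_mul_of_nonneg_left h6 rate_pos.le
      linarith
  · push Not at hA
    obtain ⟨I, hI, hne, hIN⟩ := hA
    obtain ⟨j, hj, hjmin⟩ := I.exists_min_image n hne
    exact h.combine_many hv hn (fun hi => Finset.notMem_erase i _ (hI hi)) hne (hn j) hjmin (hi' j)
      hiN (hIN j hj).le

end TaskSystem

namespace TaskSystem
open CoinTree

/-- Hierarchically well separated trees of scale `v` and size `N`. -/
inductive HTree {X : Type*} (d : X → X → ℝ) : ℝ → Set X → ℝ → Prop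
  | leaf (v : ℝ) (x : X) : HTree d v {x} 1
  | node (v : ℝ) (m : ℕ) (S : Fin (m + 1) → Set X) (n : Fin (m + 1) → ℝ) :
      (∀ i, HTree d (v / 16) (S i) (n i)) →
      (∀ x ∈ ⋃ i, S i, ∀ y ∈ ⋃ i, S i, d x y ≤ 64 * v) → Separated d S (4 * v) →
      HTree d v (⋃ i, S i) (∑ i, n i)

variable {X : Type*} {d : X → X → ℝ}

theorem HTree.one_le {v N : ℝ} {S : Set X} (h : HTree d v S N) : 1 ≤ N := by
  induction h with
  | leaf => exact le_rfl
  | node v m S n _ _ _ ih =>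
    exact (ih 0).trans (Finset.single_le_sum (f := n) (fun i _ => zero_le_one.trans (ih i))
      (Finset.mem_univ 0))

theorem HTree.nonempty {v N : ℝ} {S : Set X} (h : HTree d v S N) : S.Nonempty := by
  induction h with
  | leaf _ x => exact Set.singleton_nonempty x
  | node v m S n _ _ _ ih => exact (ih 0).mono (Set.subset_iUnion S 0)

theorem HTree.val [Finite X] (hd : ∀ x, d x x = 0) (hd0 : ∀ x y, 0 ≤ d x y)
    (htri : ∀ x y z, d x z ≤ d x y + d y z) {v N : ℝ} {S : Set X} (h : HTree d v S N)
    (hv : 0 < v) : Val d S v (1 + rate * Real.log N) := by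
  induction h with
  | leaf v x =>
    rw [Real.log_one, mul_zero, add_zero]
    exact val_singleton hd hd0 x hv.le
  | node v m S n hS hdiam hsep ih =>
    obtain ⟨V, h1, h2, h3, h4⟩ := val_iUnion hd hd0 htri hv (fun i => (hS i).nonempty) hsep hdiam
      fun i => ih i (by positivity)
    obtain ⟨C', hC', hb⟩ := ChunkCost.combine (V := V) ⟨h1, h2, h3⟩ hv.le fun i => (hS i).one_le
    refine (h4 C' hb).mono ?_ hC' hv.le
    have := Real.log_nonneg (HTree.node v m S n hS hdiam hsep).one_le
    have := rate_pos
    positivity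

theorem HTree.subtype {v N : ℝ} {S T : Set X} (h : HTree d v S N) (hT : S ⊆ T) :
    HTree (fun x y : T => d x y) v (Subtype.val ⁻¹' S) N := by
  induction h with
  | leaf v x =>
    have : (Subtype.val ⁻¹' {x} : Set T) = {⟨x, hT rfl⟩} := by
      ext y
      simp [Subtype.ext_iff]
    rw [this]
    exact HTree.leaf v _
  | node v m S n _ hdiam hsep ih =>
    rw [Set.preimage_iUnion]
    refine HTree.node v m _ n (fun i => ih i ((Set.subset_iUnion S i).trans hT)) ?_
      fun i j hij x hx y hy => hsep i j hij x hx y hy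
    rw [← Set.preimage_iUnion]
    exact fun x hx y hy => hdiam x hx y hy

variable [Fintype X]

/-- The number of points at distance at most `a` from `x`. -/
noncomputable def ballCard (d : X → X → ℝ) (a : ℝ) (x : X) : ℝ :=
  (Finset.univ.filter fun z => d z x ≤ a).card

theorem ballCard_pos (hd : ∀ x, d x x = 0) {a : ℝ} (ha : 0 ≤ a) (x : X) : 0 < ballCard d a x := by
  have : 0 < (Finset.univ.filter fun z => d z x ≤ a).card :=
    Finset.card_pos.2 ⟨x, by simp [hd, ha]⟩
  exact Nat.cast_pos.2 this

theorem sum_sum_ball (a : ℝ) (Y : Finset X) (f : X → ℝ) :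
    ∑ z, ∑ y ∈ Y with d z y ≤ a, f y = ∑ y ∈ Y, f y * ballCard d a y := by
  simp only [Finset.sum_filter]
  rw [Finset.sum_comm]
  refine Finset.sum_congr rfl fun y _ => ?_
  rw [← Finset.sum_filter, Finset.sum_const, nsmul_eq_mul, mul_comm]
  rfl

/-- Ball carving: a large part of a finite metric space splits into separated small clusters. -/
theorem exists_clusters (hd : ∀ x, d x x = 0) (hsymm : ∀ x y, d x y = d y x)
    (htri : ∀ x y z, d x z ≤ d x y + d y z) {a b : ℝ} (ha : 0 ≤ a) (hab : a ≤ b) {u : X → ℝ}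
    (hu : ∀ x, 0 < u x) (Y : Finset X) :
    ∃ (k : ℕ) (Z : Fin k → Finset X), (∀ i, (Z i).Nonempty) ∧ (∀ i, Z i ⊆ Y) ∧
      (∀ i, ∃ z, ∀ y ∈ Z i, d z y ≤ a) ∧ (∀ i j, i ≠ j → ∀ x ∈ Z i, ∀ y ∈ Z j, b - a ≤ d x y) ∧
      ∑ y ∈ Y, u y * (ballCard d a y / ballCard d b y) ≤ ∑ i, ∑ y ∈ Z i, u y := by
  induction Y using Finset.strongInduction with
  | H Y ih =>
    rcases Y.eq_empty_or_nonempty with rfl | ⟨y₀, hy₀⟩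
    · exact ⟨0, Fin.elim0, fun i => i.elim0, fun i => i.elim0, fun i => i.elim0,
        fun i => i.elim0, by simp⟩
    set f : X → ℝ := fun y => u y * (ballCard d a y / ballCard d b y) with hf
    have hapos := ballCard_pos hd ha
    have hbpos := ballCard_pos hd (ha.trans hab)
    have hfpos : ∀ y, 0 < f y := fun y => mul_pos (hu y) (div_pos (hapos y) (hbpos y))
    have hsum : ∑ z, ∑ y ∈ Y with d z y ≤ b, f y = ∑ z, ∑ y ∈ Y with d z y ≤ a, u y := by
      rw [sum_sum_ball, sum_sum_ball]
      refine Finset.sum_congr rfl fun y _ => ?_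
      have := (hbpos y).ne'
      simp only [hf]
      field_simp
    set Q := Finset.univ.filter fun z => (Y.filter fun y => d z y ≤ b).Nonempty with hQ
    obtain ⟨z, hzQ, hz⟩ : ∃ z ∈ Q, ∑ y ∈ Y with d z y ≤ b, f y ≤ ∑ y ∈ Y with d z y ≤ a, u y := by
      apply Finset.exists_le_of_sum_le ⟨y₀, ?_⟩
      · have hout : ∀ z ∉ Q, Y.filter (fun y => d z y ≤ b) = ∅ := fun z hz => by
          simpa [hQ, Finset.not_nonempty_iff_eq_empty] using hz
        rw [Finset.sum_subset (Finset.subset_univ Q), Finset.sum_subset (Finset.subset_univ Q), hsum]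
        · intro z _ hz
          have : Y.filter (fun y => d z y ≤ a) = ∅ := Finset.subset_empty.1 (by
            rw [← hout z hz]
            exact Finset.monotone_filter_right _ fun y _ hy => hy.trans hab)
          rw [this, Finset.sum_empty]
        · intro z _ hz
          rw [hout z hz, Finset.sum_empty]
      · simp only [hQ, Finset.mem_filter, Finset.mem_univ, true_and]
        exact ⟨y₀, by simp [hy₀, hd, ha.trans hab]⟩
    have hzne : (Y.filter fun y => d z y ≤ b).Nonempty := by simpa [hQ] using hzQ
    have hane : (Y.filter fun y => d z y ≤ a).Nonempty := by
      by_contra h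
      rw [Finset.not_nonempty_iff_eq_empty] at h
      rw [h, Finset.sum_empty] at hz
      exact absurd (Finset.sum_pos (fun y _ => hfpos y) hzne) (not_lt.2 hz)
    have hlt : Y.filter (fun y => ¬ d z y ≤ b) ⊂ Y := by
      obtain ⟨y, hy⟩ := hzne
      rw [Finset.mem_filter] at hy
      exact Finset.filter_ssubset.2 ⟨y, hy.1, not_not.2 hy.2⟩
    obtain ⟨k, Z, h1, h2, h3, h4, h5⟩ := ih _ hlt
    have hsep : ∀ x ∈ Y.filter (fun y => d z y ≤ a), ∀ i, ∀ y ∈ Z i, b - a ≤ d x y := by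
      intro x hx i y hy
      have hy' := (Finset.mem_filter.1 (h2 i hy)).2
      have hx' := (Finset.mem_filter.1 hx).2
      push Not at hy'
      linarith [htri z x y]
    refine ⟨k + 1, Fin.cons (Y.filter fun y => d z y ≤ a) Z, fun i => ?_, fun i => ?_, fun i => ?_,
      fun i j hij => ?_, ?_⟩
    · refine Fin.cases ?_ (fun i => ?_) i
      · simpa using hane
      · simpa using h1 i
    · refine Fin.cases ?_ (fun i => ?_) i
      · simp
      · simpa using (h2 i).trans hlt.subset
    · refine Fin.cases ?_ (fun i => ?_) i
      · exact ⟨z, by simp⟩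
      · simpa using h3 i
    · revert hij
      refine Fin.cases ?_ (fun i => ?_) i <;> refine Fin.cases ?_ (fun j => ?_) j <;> intro hij
      · exact absurd rfl hij
      · simpa only [Fin.cons_zero, Fin.cons_succ] using fun x hx y hy => hsep x hx j y hy
      · simp only [Fin.cons_zero, Fin.cons_succ]
        intro x hx y hy
        rw [hsymm]
        exact hsep y hy i x hx
      · simpa only [Fin.cons_succ] using h4 i j fun h => hij (h ▸ rfl)
    · rw [Fin.sum_univ_succ, ← Finset.sum_filter_add_sum_filter_not Y fun y => d z y ≤ b]
      simp only [Fin.cons_zero, Fin.cons_succ]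
      exact add_le_add hz h5

/-- A two-scale clustering whose quality is controlled by the growth of balls. -/
theorem exists_clusters_sqrt (hd : ∀ x, d x x = 0) (hsymm : ∀ x y, d x y = d y x)
    (htri : ∀ x y z, d x z ≤ d x y + d y z) {r : ℝ} (hr : 0 ≤ r) (Y : Finset X) :
    ∃ (k : ℕ) (Z : Fin k → Finset X), (∀ i, (Z i).Nonempty) ∧ (∀ i, Z i ⊆ Y) ∧
      (∀ i, ∀ x ∈ Z i, ∀ y ∈ Z i, d x y ≤ r / 4) ∧
      (∀ i j, i ≠ j → ∀ x ∈ Z i, ∀ y ∈ Z j, r / 16 ≤ d x y) ∧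
      ∑ y ∈ Y, 1 / √(ballCard d (r / 4) y) ≤ ∑ i, ∑ y ∈ Z i, 1 / √(ballCard d (r / 4 / 4) y) := by
  set u : X → ℝ := fun y => 1 / √(ballCard d (r / 4 / 4) y) with hu
  have hpos : ∀ a : ℝ, 0 ≤ a → ∀ y, 0 < ballCard d a y := fun a ha => ballCard_pos hd ha
  have hupos : ∀ y, 0 < u y := fun y =>
    one_div_pos.2 (Real.sqrt_pos.2 (hpos _ (by positivity) y))
  have key : ∀ a b : ℝ, 0 ≤ a → a ≤ r / 8 → r / 16 ≤ b - a →
      ∑ y ∈ Y, 1 / √(ballCard d (r / 4) y) ≤ ∑ y ∈ Y, u y * (ballCard d a y / ballCard d b y) →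
      ∃ (k : ℕ) (Z : Fin k → Finset X), (∀ i, (Z i).Nonempty) ∧ (∀ i, Z i ⊆ Y) ∧
      (∀ i, ∀ x ∈ Z i, ∀ y ∈ Z i, d x y ≤ r / 4) ∧
      (∀ i j, i ≠ j → ∀ x ∈ Z i, ∀ y ∈ Z j, r / 16 ≤ d x y) ∧
      ∑ y ∈ Y, 1 / √(ballCard d (r / 4) y) ≤ ∑ i, ∑ y ∈ Z i, u y := by
    intro a b ha ha' hab hsum
    obtain ⟨k, Z, h1, h2, h3, h4, h5⟩ :=
      exists_clusters hd hsymm htri ha (by linarith : a ≤ b) hupos Y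
    refine ⟨k, Z, h1, h2, fun i x hx y hy => ?_,
      fun i j hij x hx y hy => hab.trans (h4 i j hij x hx y hy), hsum.trans h5⟩
    obtain ⟨z, hz⟩ := h3 i
    have := hz x hx
    have := hz y hy
    have := htri x z y
    rw [hsymm x z] at this
    linarith
  have hamgm : ∀ y, 2 * (1 / √(ballCard d (r / 4) y)) ≤
      u y * (ballCard d (r / 4 / 4) y / ballCard d (r / 8) y) +
      u y * (ballCard d (r / 8) y / ballCard d (r / 4) y) := by
    intro y
    have h1 := hpos (r / 4 / 4) (by positivity) y
    have h2 := hpos (r / 8) (by positivity) y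
    have h3 := hpos (r / 4) (by positivity) y
    simp only [hu]
    obtain ⟨p, hp, hp'⟩ : ∃ p, 0 < p ∧ ballCard d (r / 4 / 4) y = p ^ 2 :=
      ⟨_, Real.sqrt_pos.2 h1, (Real.sq_sqrt h1.le).symm⟩
    obtain ⟨q, hq, hq'⟩ : ∃ q, 0 < q ∧ ballCard d (r / 4) y = q ^ 2 :=
      ⟨_, Real.sqrt_pos.2 h3, (Real.sq_sqrt h3.le).symm⟩
    set c := ballCard d (r / 8) y
    rw [hp', hq', Real.sqrt_sq hp.le, Real.sqrt_sq hq.le]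
    have : 1 / p * (p ^ 2 / c) + 1 / p * (c / q ^ 2) - 2 * (1 / q) =
        (p * q - c) ^ 2 / (p * c * q ^ 2) := by
      field_simp
      ring
    have h4 : 0 ≤ (p * q - c) ^ 2 / (p * c * q ^ 2) := by positivity
    linarith
  have hs := Finset.sum_le_sum fun y (_ : y ∈ Y) => hamgm y
  rw [← Finset.mul_sum, Finset.sum_add_distrib] at hs
  by_cases hc : ∑ y ∈ Y, 1 / √(ballCard d (r / 4) y) ≤
      ∑ y ∈ Y, u y * (ballCard d (r / 4 / 4) y / ballCard d (r / 8) y)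
  · exact key _ _ (by positivity) (by linarith) (by linarith) hc
  · push Not at hc
    exact key (r / 8) (r / 4) (by positivity) le_rfl (by linarith) (by linarith)

theorem exists_htree_pair (hd : ∀ x, d x x = 0) (hsymm : ∀ x y, d x y = d y x)
    (htri : ∀ x y z, d x z ≤ d x y + d y z) {δ : ℝ} (hδ : ∀ x y, x ≠ y → δ ≤ d x y) (k : ℕ)
    {r : ℝ} (hr : 0 ≤ r) (hk : r < 4 ^ k * δ) {Y : Finset X} (hY : Y.Nonempty)
    (hdiam : ∀ x ∈ Y, ∀ y ∈ Y, d x y ≤ r) :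
    ∃ (S₀ S₁ : Set X) (N₀ N₁ : ℝ), S₀ ⊆ Y ∧ S₁ ⊆ Y ∧ HTree d (r / 64) S₀ N₀ ∧
      HTree d (r / 256) S₁ N₁ ∧ ∑ y ∈ Y, 1 / √(ballCard d (r / 4) y) ≤ N₀ * N₁ := by
  induction k generalizing r Y with
  | zero =>
    obtain ⟨x, hx⟩ := hY
    have hYx : Y = {x} := by
      refine Finset.eq_singleton_iff_unique_mem.2 ⟨hx, fun y hy => ?_⟩
      by_contra h
      have := hδ y x h
      have := hdiam y hy x hx
      rw [pow_zero, one_mul] at hk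
      linarith
    refine ⟨{x}, {x}, 1, 1, by simpa using hx, by simpa using hx, HTree.leaf _ x,
      HTree.leaf _ x, ?_⟩
    rw [hYx, Finset.sum_singleton, mul_one]
    have h1 : 0 < ballCard d (r / 4) x := ballCard_pos hd (by positivity) x
    have h2 : (1 : ℝ) ≤ ballCard d (r / 4) x := by
      unfold ballCard at h1 ⊢
      exact_mod_cast h1
    rw [div_le_one (Real.sqrt_pos.2 h1)]
    exact Real.one_le_sqrt.2 h2
  | succ k ih =>
    obtain ⟨m, Z, h1, h2, h3, h4, h5⟩ := exists_clusters_sqrt hd hsymm htri hr Y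
    cases m with
    | zero =>
      rw [Finset.univ_eq_empty, Finset.sum_empty] at h5
      exact absurd (Finset.sum_pos (fun y _ => one_div_pos.2
        (Real.sqrt_pos.2 (ballCard_pos hd (by positivity) y))) hY) (not_lt.2 h5)
    | succ m =>
      have hk' : r / 4 < 4 ^ k * δ := by
        rw [pow_succ] at hk
        linarith
      choose S₀ S₁ N₀ N₁ hS₀ hS₁ hT₀ hT₁ hN using fun i =>
        ih (by positivity) hk' (h1 i) (h3 i)
      obtain ⟨j, -, hj⟩ := Finset.univ.exists_max_image N₀ Finset.univ_nonempty
      have hsub : ⋃ i, S₁ i ⊆ (Y : Set X) := Set.iUnion_subset fun i =>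
        (hS₁ i).trans (Finset.coe_subset.2 (h2 i))
      refine ⟨⋃ i, S₁ i, S₀ j, ∑ i, N₁ i, N₀ j, hsub,
        (hS₀ j).trans (Finset.coe_subset.2 (h2 j)), ?_, ?_, ?_⟩
      · refine HTree.node _ m S₁ N₁ (fun i => ?_) (fun x hx y hy => ?_) fun i i' hi x hx y hy => ?_
        · convert hT₁ i using 1
          ring
        · have := hdiam x (hsub hx) y (hsub hy)
          linarith
        · have := h4 i i' hi x (hS₁ i hx) y (hS₁ i' hy)
          linarith
      · convert hT₀ j using 1
        ring
      · refine h5.trans ?_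
        rw [Finset.sum_mul]
        refine Finset.sum_le_sum fun i _ => (hN i).trans ?_
        rw [mul_comm]
        exact mul_le_mul_of_nonneg_left (hj i (Finset.mem_univ i))
          (zero_le_one.trans (hT₁ i).one_le)

theorem exists_htree [Nonempty X] (hd : ∀ x y, d x y = 0 ↔ x = y) (hd0 : ∀ x y, 0 ≤ d x y)
    (hsymm : ∀ x y, d x y = d y x) (htri : ∀ x y z, d x z ≤ d x y + d y z) :
    ∃ (v : ℝ) (S : Set X) (N : ℝ), 0 < v ∧ HTree d v S N ∧
      Real.log (Fintype.card X) ≤ 4 * Real.log N := by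
  have hdd : ∀ x, d x x = 0 := fun x => (hd x x).2 rfl
  obtain ⟨δ, hδ0, hδ⟩ : ∃ δ : ℝ, 0 < δ ∧ ∀ x y, x ≠ y → δ ≤ d x y := by
    have hfin : (Set.range fun p : {p : X × X // p.1 ≠ p.2} => d p.1.1 p.1.2).Finite :=
      Set.finite_range _
    obtain ⟨⟨δ, hδ⟩, h⟩ : ∃ δ : Set.Ioi (0 : ℝ), ∀ p : {p : X × X // p.1 ≠ p.2},
        (δ : ℝ) ≤ d p.1.1 p.1.2 := by
      rcases isEmpty_or_nonempty {p : X × X // p.1 ≠ p.2} with he | he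
      · exact ⟨⟨1, Set.mem_Ioi.2 one_pos⟩, fun p => he.elim p⟩
      · obtain ⟨p, hp⟩ := Finite.exists_min fun p : {p : X × X // p.1 ≠ p.2} => d p.1.1 p.1.2
        exact ⟨⟨d p.1.1 p.1.2, (hd0 _ _).lt_of_ne fun h => p.2 ((hd _ _).1 h.symm)⟩, hp⟩
    exact ⟨δ, hδ, fun x y hxy => h ⟨(x, y), hxy⟩⟩
  obtain ⟨R, hR⟩ := (Set.finite_range fun p : X × X => d p.1 p.2).bddAbove
  set r := max R 1 with hr
  have hr0 : 0 < r := lt_of_lt_of_le one_pos (le_max_right _ _)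
  obtain ⟨k, hk⟩ := pow_unbounded_of_one_lt (r / δ) (show (1 : ℝ) < 4 by norm_num)
  rw [div_lt_iff₀ hδ0] at hk
  obtain ⟨S₀, S₁, N₀, N₁, -, -, hT₀, hT₁, hN⟩ := exists_htree_pair hdd hsymm htri hδ k hr0.le hk
    (Y := Finset.univ) Finset.univ_nonempty
    fun x _ y _ => (hR ⟨(x, y), rfl⟩).trans (le_max_left _ _)
  have hn : (0 : ℝ) < Fintype.card X := by exact_mod_cast Fintype.card_pos
  have h1 : √(Fintype.card X) ≤ N₀ * N₁ := by
    refine le_trans ?_ hN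
    calc √(Fintype.card X : ℝ) = ∑ y : X, 1 / √(Fintype.card X : ℝ) := by
          rw [Finset.sum_const, nsmul_eq_mul, Finset.card_univ, mul_one_div, Real.div_sqrt]
      _ ≤ _ := by
          refine Finset.sum_le_sum fun y _ => ?_
          apply one_div_le_one_div_of_le
            (Real.sqrt_pos.2 (ballCard_pos hdd (by positivity) y))
          apply Real.sqrt_le_sqrt
          unfold ballCard
          exact_mod_cast Finset.card_le_univ _
  have h2 := Real.log_le_log (Real.sqrt_pos.2 hn) h1
  rw [Real.log_sqrt hn.le, Real.log_mul (by linarith [hT₀.one_le]) (by linarith [hT₁.one_le])] at h2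
  by_cases hc : Real.log N₁ ≤ Real.log N₀
  · exact ⟨_, S₀, N₀, by positivity, hT₀, by linarith⟩
  · exact ⟨_, S₁, N₁, by positivity, hT₁, by linarith⟩

end TaskSystem

theorem mtsCost_cons {M : Type*} (d : M → M → ℝ) (A : List (M → ℝ≥0∞) → M) (x : M)
    (r : M → ℝ≥0∞) (σ : List (M → ℝ≥0∞)) :
    mtsCost d A x (r :: σ) = ENNReal.ofReal (d x (A [r])) + r (A [r]) +
      mtsCost d (fun l => A (r :: l)) (A [r]) σ := by
  have h : ∀ t, mtsState A x (r :: σ) (t + 1) = mtsState (fun l => A (r :: l)) (A [r]) σ t := by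
    intro t
    cases t <;> simp [mtsState]
  have h0 : mtsState A x (r :: σ) 0 = x := rfl
  have h1 : mtsState A x (r :: σ) 1 = A [r] := by simp [mtsState]
  simp only [mtsCost, List.length_cons]
  rw [Finset.sum_range_succ', add_comm, zero_add, h0, h1]
  simp [h]

theorem mtsOpt_cons_le {M : Type*} (d : M → M → ℝ) (x y : M) (r : M → ℝ≥0∞)
    (σ : List (M → ℝ≥0∞)) :
    mtsOpt d x (r :: σ) ≤ ENNReal.ofReal (d x y) + r y + mtsOpt d y σ := by
  rw [mtsOpt, mtsOpt, ENNReal.add_iInf]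
  refine le_iInf fun s => iInf_le_of_le ⟨fun t => Nat.casesOn t x s.1, rfl⟩ ?_
  rw [List.length_cons, Finset.sum_range_succ', add_comm]
  simp [s.2]

theorem le_mtsOpt_append_singleton {M : Type*} {d : M → M → ℝ} {x : M} {r : M → ℝ≥0∞}
    {σ : List (M → ℝ≥0∞)} {a : ℝ≥0∞} (h : ∀ y, a ≤ r y) : a ≤ mtsOpt d x (σ ++ [r]) := by
  refine le_iInf fun s => ?_
  rw [List.length_append, List.length_singleton, Finset.sum_range_succ]
  refine le_trans ?_ le_add_self
  refine le_trans ?_ le_add_self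
  simpa using h _

namespace TaskSystem
open CoinTree

variable {M : Type*} {S : Set M}

/-- The cost vector on `M` that agrees with `r` on `S` and forbids all other states. -/
noncomputable def extend (S : Set M) (r : S → ℝ≥0) (x : M) : ℝ≥0∞ :=
  if h : x ∈ S then (r ⟨x, h⟩ : ℝ≥0∞) else ⊤

theorem extend_coe (r : S → ℝ≥0) (x : S) : extend S r x = r x := by
  simp [extend]

theorem run_le_mtsCost (d : M → M → ℝ) (A : List (M → ℝ≥0∞) → M)
    (A' : List (S → ℝ≥0) → S)
    (h : ∀ l, A (l.map (extend S)) ∈ S → (A' l : M) = A (l.map (extend S))) (x : S)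
    (σ : List (S → ℝ≥0)) :
    ENNReal.ofReal (run (fun x y : S => d x y) (fun _ => 0) A' x σ) ≤
      mtsCost d A x (σ.map (extend S)) := by
  induction σ generalizing A A' x with
  | nil => simp [run]
  | cons r σ ih =>
    rw [List.map_cons, mtsCost_cons]
    by_cases hA : A [extend S r] ∈ S
    · have hA' : (A' [r] : M) = A [extend S r] := h [r] hA
      rw [← hA', extend_coe, run]
      refine (ENNReal.ofReal_add_le).trans (add_le_add (ENNReal.ofReal_add_le.trans ?_) ?_)
      · simp
      · exact ih (fun l => A (extend S r :: l)) (fun l => A' (r :: l)) (fun l hl => h (r :: l) hl) _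
    · simp [extend, hA]

theorem Serve.mtsOpt_le {d : M → M → ℝ} {x w : S} {σ : List (S → ℝ≥0)} {z : ℝ}
    (hd : ∀ x y, 0 ≤ d x y) (h : Serve (fun x y : S => d x y) Set.univ x σ w z) :
    mtsOpt d x (σ.map (extend S)) ≤ ENNReal.ofReal z := by
  induction h with
  | nil x => exact iInf_le_of_le ⟨fun _ => x, rfl⟩ (by simp)
  | @cons x y w r σ z _ hs ih =>
    have hz : 0 ≤ z := Serve.nonneg (fun x y : S => hd x y) hs
    rw [List.map_cons, ENNReal.ofReal_add (add_nonneg (hd x y) (r y).coe_nonneg) hz,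
      ENNReal.ofReal_add (hd x y) (r y).coe_nonneg, ENNReal.ofReal_coe_nnreal, ← extend_coe]
    exact (mtsOpt_cons_le d x y _ _).trans (by gcongr)

theorem mtsOpt_le_om [Finite M] {d : M → M → ℝ} (hd : ∀ x, d x x = 0) (hd0 : ∀ x y, 0 ≤ d x y)
    (x : S) (σ : List (S → ℝ≥0)) :
    mtsOpt d x (σ.map (extend S)) ≤
      ENNReal.ofReal (om (fun x y : S => d x y) Set.univ σ) := by
  have key : ∀ z, Can (fun x y : S => d x y) Set.univ σ z →
      mtsOpt d x (σ.map (extend S)) ≤ ENNReal.ofReal z := fun z hz => by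
    obtain ⟨w, z', hz', hs⟩ := hz x (Set.mem_univ x)
    exact (hs.mtsOpt_le hd0).trans (ENNReal.ofReal_le_ofReal hz')
  obtain ⟨z₀, hz₀⟩ := exists_can (d := fun x y : S => d x y) (S := Set.univ) (fun x => hd x) σ
  have hfin : mtsOpt d x (σ.map (extend S)) ≠ ⊤ := ne_top_of_le_ne_top ENNReal.ofReal_ne_top
    (key z₀ hz₀)
  rw [← ENNReal.ofReal_toReal hfin]
  refine ENNReal.ofReal_le_ofReal (le_om (fun x : S => hd x) fun z hz => ?_)
  obtain ⟨w, z', hz', hs⟩ := hz x (Set.mem_univ x)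
  have hz0 : 0 ≤ z := (Serve.nonneg (fun x y : S => hd0 x y) hs).trans hz'
  exact ENNReal.toReal_le_of_le_ofReal hz0 (key z hz)

theorem Val.mtsDLB [Finite M] {d : M → M → ℝ} (hd : ∀ x, d x x = 0) (hd0 : ∀ x y, 0 ≤ d x y)
    {v C : ℝ} (h : Val (fun x y : S => d x y) Set.univ v C) (hv : 0 < v) (hC : 0 < C) (x₀ : S) :
    MtsDLB d x₀ (C / 3) := by
  intro B hB
  obtain ⟨p, -, hon, hopt⟩ := h
  have hρ : 0 < v / C := div_pos hv hC
  obtain ⟨k, hk⟩ := exists_nat_ge ((B + 512 * v) / (v / C))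
  rw [div_le_iff₀ hρ] at hk
  obtain ⟨a, ha⟩ : ∃ a : ℝ≥0, (a : ℝ) = v / C * k := ⟨⟨v / C * k, by positivity⟩, rfl⟩
  have hS : (Set.univ : Set S).Nonempty := ⟨x₀, Set.mem_univ _⟩
  have hdd : ∀ x : S, d x x = 0 := fun x => hd x
  have hdd0 : ∀ x y : S, 0 ≤ d x y := fun x y => hd0 x y
  obtain ⟨N, P, ρ, hP0, hP1, hev, hall⟩ := exists_finite_distribution
    (seq (pow p k) (leaf [fun _ : S => a]))
  have hlast : ∀ i, ∃ τ, ρ i = τ ++ [fun _ : S => a] :=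
    hall (fun σ => ∃ τ, σ = τ ++ [fun _ : S => a]) (All.seq (P := fun _ => True)
      (Q := fun σ => σ = [fun _ : S => a]) (fun σ τ _ hτ => ⟨σ, by rw [hτ]⟩)
      (all_true (fun _ => trivial) _) rfl)
  have hE : ∑ i, P i * om (fun x y : S => d x y) Set.univ (ρ i) ≤ 3 * (v / C * k) := by
    rw [hev, ev_seq]
    simp only [ev]
    calc _ ≤ ev (fun σ => om (fun x y : S => d x y) Set.univ σ + a) (pow p k) := by
          refine ev_mono (fun σ => ?_) _
          exact (om_append_le hdd hdd0 hS σ _).trans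
            (add_le_add le_rfl (om_const_le hdd hdd0 hS a))
      _ ≤ _ := by
          rw [ev_add_const]
          linarith [hopt k]
  have hsum : ∑ i, ENNReal.ofReal (P i) = 1 := by
    rw [← ENNReal.ofReal_sum_of_nonneg fun i _ => hP0 i, hP1, ENNReal.ofReal_one]
  refine ⟨N, fun i => ENNReal.ofReal (P i), fun i => (ρ i).map (extend S), hsum, ?_, fun A => ?_⟩
  · rw [← one_mul (ENNReal.ofReal B), ← hsum, Finset.sum_mul]
    refine Finset.sum_le_sum fun i _ => mul_le_mul_right ?_ _
    obtain ⟨τ, hτ⟩ := hlast i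
    simp only [hτ, List.map_append, List.map_singleton]
    refine le_mtsOpt_append_singleton fun y => ?_
    by_cases hy : y ∈ S
    · simp only [extend, hy, dif_pos]
      rw [← ENNReal.ofReal_coe_nnreal, ha]
      exact ENNReal.ofReal_le_ofReal (by linarith)
    · simp [extend, hy]
  · let A' : List (S → ℝ≥0) → S := fun l =>
      if h : A (l.map (extend S)) ∈ S then ⟨A (l.map (extend S)), h⟩ else x₀
    have hA' : ∀ l, A (l.map (extend S)) ∈ S → (A' l : M) = A (l.map (extend S)) :=
      fun l hl => by simp [A', hl]
    have hpow := hon.pow hv.le (g := fun _ => 0) (fun x y => by simpa using hdd0 x y)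
      (fun _ _ _ _ => rfl) k (fun x y => by simpa [bump] using hdd0 x y) A' x₀
    have hA : k * v ≤ ∑ i, P i * run (fun x y : S => d x y) (fun _ => 0) A' x₀ (ρ i) := by
      rw [hev, ev_seq]
      simp only [ev]
      refine le_trans (by simpa [bump] using hpow) (ev_mono (fun σ => ?_) _)
      rw [run_append]
      exact run_mono (fun y => run_nonneg hdd0 (fun _ => le_rfl) _ _ _) _ _ _
    calc ENNReal.ofReal (C / 3) * ∑ i, ENNReal.ofReal (P i) * mtsOpt d x₀ ((ρ i).map (extend S))
        ≤ ENNReal.ofReal (C / 3) * ∑ i, ENNReal.ofReal (P i) *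
            ENNReal.ofReal (om (fun x y : S => d x y) Set.univ (ρ i)) := by
          gcongr with i
          exact mtsOpt_le_om hd hd0 x₀ (ρ i)
      _ = ENNReal.ofReal (C / 3 * ∑ i, P i * om (fun x y : S => d x y) Set.univ (ρ i)) := by
          rw [ENNReal.ofReal_mul (by positivity), ENNReal.ofReal_sum_of_nonneg fun i _ =>
            mul_nonneg (hP0 i) (om_nonneg hdd0 hS _)]
          simp only [ENNReal.ofReal_mul (hP0 _)]
      _ ≤ ENNReal.ofReal (∑ i, P i * run (fun x y : S => d x y) (fun _ => 0) A' x₀ (ρ i)) := by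
          refine ENNReal.ofReal_le_ofReal (le_trans ?_ hA)
          calc _ ≤ C / 3 * (3 * (v / C * k)) := by gcongr
            _ = k * v := by field_simp
      _ = ∑ i, ENNReal.ofReal (P i) *
            ENNReal.ofReal (run (fun x y : S => d x y) (fun _ => 0) A' x₀ (ρ i)) := by
          rw [ENNReal.ofReal_sum_of_nonneg fun i _ =>
            mul_nonneg (hP0 i) (run_nonneg hdd0 (fun _ => le_rfl) _ _ _)]
          simp only [ENNReal.ofReal_mul (hP0 _)]
      _ ≤ _ := by
          gcongr with i
          exact run_le_mtsCost d A A' hA' x₀ (ρ i)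

end TaskSystem

theorem MtsDLB.mono {M : Type*} {d : M → M → ℝ} {x₀ : M} {C C' : ℝ} (h : MtsDLB d x₀ C)
    (hC : C' ≤ C) : MtsDLB d x₀ C' := by
  intro B hB
  obtain ⟨N, P, ρ, h1, h2, h3⟩ := h B hB
  exact ⟨N, P, ρ, h1, h2, fun A => le_trans (by gcongr) (h3 A)⟩

universe u

/-- There is an absolute constant `c > 0` such that on *every*
`n`-point metric space (`n ≥ 2`), `c·log n` is a distributional lower bound for
metrical task systems (for a suitable initial state). -/
theorem mts_universal_log_lower_bound :
    ∃ c : ℝ, 0 < c ∧ ∀ n : ℕ, 2 ≤ n →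
      ∀ (M : Type u) (d : M → M → ℝ), Finite M → Nat.card M = n → IsMetric d →
        ∃ x₀ : M, MtsDLB d x₀ (c * Real.log n) := by
  refine ⟨TaskSystem.rate / 12, div_pos TaskSystem.rate_pos (by norm_num), ?_⟩
  rintro n hn M d hfin hcard ⟨hd, hsymm, htri⟩
  have : Nonempty M := Finite.card_pos_iff.1 (by omega)
  have : Fintype M := Fintype.ofFinite M
  have hd0 : ∀ x y, 0 ≤ d x y := fun x y => by
    linarith [htri x y x, hsymm x y, (hd x x).2 rfl]
  obtain ⟨v, S, N, hv, hT, hN⟩ := TaskSystem.exists_htree hd hd0 hsymm htri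
  rw [← Nat.card_eq_fintype_card, hcard] at hN
  obtain ⟨x₀, hx₀⟩ := hT.nonempty
  have hS := hT.subtype subset_rfl
  rw [Subtype.coe_preimage_self] at hS
  have hr := TaskSystem.rate_pos
  have hlog : 0 ≤ Real.log N := Real.log_nonneg hT.one_le
  have hval := TaskSystem.HTree.val (fun x : S => (hd x x).2 rfl) (fun x y : S => hd0 x y)
    (fun x y z : S => htri x y z) hS hv
  refine ⟨x₀, (hval.mtsDLB (fun x => (hd x x).2 rfl) hd0 hv (by positivity) ⟨x₀, hx₀⟩).mono ?_⟩
  nlinarith [mul_le_mul_of_nonneg_left hN hr.le]
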